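/- arXiv:math/0603570 — 2 statements merged into one kernel-verified Lean document; each statement's English description precedes it below -/
import Mathlib

section
/- Let N ≥ 1, T > 0, and let c : ℝ^N × [0,T] → ℝ be continuous and satisfy (H1), and let u0 : ℝ^N → ℝ be Lipschitz continuous. Then the equation u_t = c(x,t)|Du| with initial datum u0 has exactly one Lipschitz continuous viscosity solution u : ℝ^N × [0,T] → ℝ, and this solution satisfies, at almost every (x,t) ∈ ℝ^N × (0,T), |Du(x,t)| ≤ e^{L1 T}·Lip(u0) and |u_t(x,t)| ≤ L1'·e^{L1 T}·Lip(u0), where Lip(u0) denotes the Lipschitz constant of u0. -/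
open Set MeasureTheory Filter Metric
open scoped Topology ENNReal NNReal RealInnerProductSpace symmDiff

noncomputable section

/-- Euclidean space ℝ^N. -/
abbrev Euc (N : ℕ) := EuclideanSpace ℝ (Fin N)

/-- The Fréchet superdifferential D⁺v(x): the set of p with
limsup_{y→x} (v(y) − v(x) − ⟨p, y−x⟩)/|y−x| ≤ 0. -/
def SuperDiff {N : ℕ} (v : Euc N → ℝ) (x : Euc N) : Set (Euc N) :=
  {p | ∀ ε > 0, ∀ᶠ y in 𝓝[≠] x, (v y - v x - ⟪p, y - x⟫) / ‖y - x‖ ≤ ε}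

/-- Semiconvexity with constant C: v(x+h) − 2v(x) + v(x−h) ≥ −C|h|². -/
def Semiconvex {N : ℕ} (C : ℝ) (v : Euc N → ℝ) : Prop :=
  ∀ x h : Euc N, v (x + h) - 2 * v x + v (x - h) ≥ -C * ‖h‖ ^ 2

/-- Viscosity solution of u_t = c(x,t)|Du| on ℝ^N × (0,T) with initial datum u0. -/
def IsViscositySolution (N : ℕ) (T : ℝ) (c u : Euc N → ℝ → ℝ) (u0 : Euc N → ℝ) : Prop :=
  (∀ x, u x 0 = u0 x) ∧
  ∀ φ : Euc N → ℝ → ℝ,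
    ContDiff ℝ 1 (fun p : Euc N × ℝ => φ p.1 p.2) →
    ∀ x0 : Euc N, ∀ t0 ∈ Set.Ioo 0 T,
      (IsLocalMaxOn (fun p : Euc N × ℝ => u p.1 p.2 - φ p.1 p.2)
          (Set.univ ×ˢ Set.Icc 0 T) (x0, t0) →
        deriv (φ x0) t0 ≤ c x0 t0 * ‖gradient (fun x => φ x t0) x0‖) ∧
      (IsLocalMinOn (fun p : Euc N × ℝ => u p.1 p.2 - φ p.1 p.2)
          (Set.univ ×ˢ Set.Icc 0 T) (x0, t0) →
        deriv (φ x0) t0 ≥ c x0 t0 * ‖gradient (fun x => φ x t0) x0‖)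

/-- The signed dilation operator: the supremum of `f` over the closed ball of radius `r` if `0 ≤ r`,
the infimum over the closed ball of radius `-r` otherwise. -/
def ballStep {N : ℕ} (r : ℝ) (f : Euc N → ℝ) (x : Euc N) : ℝ :=
  if 0 ≤ r then sSup (f '' closedBall x r) else sInf (f '' closedBall x (-r))

lemma ballStep_zero {N : ℕ} (f : Euc N → ℝ) (x : Euc N) : ballStep 0 f x = f x := by
  simp [ballStep]

lemma ballStep_neg {N : ℕ} (r : ℝ) (f : Euc N → ℝ) (x : Euc N) :
    ballStep (-r) (fun y => -f y) x = -ballStep r f x := by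
  have himg : ∀ s : Set (Euc N), (fun y => -f y) '' s = -(f '' s) := by
    intro s
    rw [← Set.image_neg_eq_neg, Set.image_image]
  rcases lt_trichotomy r 0 with h | h | h
  · rw [ballStep, ballStep, if_pos (by linarith), if_neg (by linarith), himg, Real.sSup_neg]
  · subst h
    simp [ballStep_zero]
  · rw [ballStep, ballStep, if_neg (by linarith), if_pos (by linarith), himg, Real.sInf_neg, neg_neg]

lemma le_ballStep {N : ℕ} {r : ℝ} {f : Euc N → ℝ} (hf : Continuous f) (hr : 0 ≤ r) {x z : Euc N}
    (hz : ‖z - x‖ ≤ r) : f z ≤ ballStep r f x := by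
  rw [ballStep, if_pos hr]
  exact le_csSup ((isCompact_closedBall x r).image hf).bddAbove
    ⟨z, by simpa [dist_eq_norm] using hz, rfl⟩

lemma exists_ballStep_eq {N : ℕ} {r : ℝ} {f : Euc N → ℝ} (hf : Continuous f) (hr : 0 ≤ r)
    (x : Euc N) : ∃ z, ‖z - x‖ ≤ r ∧ ballStep r f x = f z := by
  rw [ballStep, if_pos hr]
  obtain ⟨z, hz, he⟩ := ((isCompact_closedBall x r).image hf).sSup_mem
    ⟨f x, x, by simpa using hr, rfl⟩
  exact ⟨z, by simpa [dist_eq_norm] using hz, he.symm⟩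

lemma ballStep_le {N : ℕ} {r : ℝ} {f : Euc N → ℝ} (hf : Continuous f) (hr : r ≤ 0) {x z : Euc N}
    (hz : ‖z - x‖ ≤ -r) : ballStep r f x ≤ f z := by
  have h := le_ballStep (f := fun y => -f y) hf.neg (r := -r) (by linarith) hz
  rw [ballStep_neg] at h
  linarith

lemma exists_dist_le_of_radius {N : ℕ} {r s : ℝ} (hr : 0 ≤ r) (hs : 0 ≤ s) {x z : Euc N} (y : Euc N)
    (hz : ‖z - x‖ ≤ r) : ∃ z', ‖z' - y‖ ≤ s ∧ ‖z - z'‖ ≤ ‖x - y‖ + |r - s| := by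
  rcases le_or_gt r s with h | h
  · refine ⟨y + (z - x), by simpa using hz.trans h, ?_⟩
    have : z - (y + (z - x)) = x - y := by abel
    rw [this]
    linarith [abs_nonneg (r - s)]
  · have hr0 : 0 < r := lt_of_le_of_lt hs h
    refine ⟨y + (s / r) • (z - x), ?_, ?_⟩
    · rw [add_sub_cancel_left, norm_smul, Real.norm_of_nonneg (by positivity)]
      calc s / r * ‖z - x‖ ≤ s / r * r := by gcongr
        _ = s := by field_simp
    · have : z - (y + (s / r) • (z - x)) = (x - y) + ((r - s) / r) • (z - x) := by
        have h1 : (r - s) / r = 1 - s / r := by field_simp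
        rw [h1, sub_smul, one_smul]
        abel
      rw [this, abs_of_pos (by linarith)]
      refine (norm_add_le _ _).trans ?_
      rw [norm_smul, Real.norm_of_nonneg (div_nonneg (by linarith) hr)]
      have : (r - s) / r * ‖z - x‖ ≤ (r - s) / r * r := by
        have : 0 ≤ (r - s) / r := div_nonneg (by linarith) hr
        gcongr
      have h2 : (r - s) / r * r = r - s := by field_simp
      linarith

lemma continuous_of_abs_sub_le {N : ℕ} {A : ℝ} {f : Euc N → ℝ}
    (hf : ∀ x y, |f x - f y| ≤ A * ‖x - y‖) : Continuous f :=
  (LipschitzWith.of_dist_le' (K := A) (fun x y => by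
    simpa [Real.dist_eq, dist_eq_norm] using hf x y)).continuous

lemma ballStep_le_add {N : ℕ} {A r s : ℝ} {f : Euc N → ℝ} (hA : 0 ≤ A)
    (hf : ∀ x y, |f x - f y| ≤ A * ‖x - y‖) (hr : 0 ≤ r) (hs : 0 ≤ s) (x y : Euc N) :
    ballStep r f x ≤ ballStep s f y + A * (‖x - y‖ + |r - s|) := by
  have hcont := continuous_of_abs_sub_le hf
  obtain ⟨z, hz, he⟩ := exists_ballStep_eq hcont hr x
  obtain ⟨z', hz', hd⟩ := exists_dist_le_of_radius hr hs y hz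
  have h1 := le_ballStep hcont hs hz'
  have h2 := (abs_le.1 (hf z z')).2
  have h3 : A * ‖z - z'‖ ≤ A * (‖x - y‖ + |r - s|) := by gcongr
  linarith

lemma abs_ballStep_sub_of_nonneg {N : ℕ} {A r s : ℝ} {f : Euc N → ℝ} (hA : 0 ≤ A)
    (hf : ∀ x y, |f x - f y| ≤ A * ‖x - y‖) (hr : 0 ≤ r) (hs : 0 ≤ s) (x y : Euc N) :
    |ballStep r f x - ballStep s f y| ≤ A * (‖x - y‖ + |r - s|) := by
  have h1 := ballStep_le_add hA hf hr hs x y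
  have h2 := ballStep_le_add hA hf hs hr y x
  rw [norm_sub_rev, abs_sub_comm] at h2
  rw [abs_le]
  constructor <;> linarith

lemma abs_ballStep_sub_of_nonpos {N : ℕ} {A r s : ℝ} {f : Euc N → ℝ} (hA : 0 ≤ A)
    (hf : ∀ x y, |f x - f y| ≤ A * ‖x - y‖) (hr : r ≤ 0) (hs : s ≤ 0) (x y : Euc N) :
    |ballStep r f x - ballStep s f y| ≤ A * (‖x - y‖ + |r - s|) := by
  have h := abs_ballStep_sub_of_nonneg (f := fun y => -f y) (r := -r) (s := -s) hA
    (fun x y => by rw [neg_sub_neg, abs_sub_comm]; exact hf x y) (by linarith) (by linarith) x y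
  rwa [ballStep_neg, ballStep_neg, neg_sub_neg, neg_sub_neg, abs_sub_comm, abs_sub_comm s] at h

/-- `ballStep` is jointly Lipschitz in the radius and the center. -/
lemma abs_ballStep_sub_le {N : ℕ} {A : ℝ} {f : Euc N → ℝ} (hA : 0 ≤ A)
    (hf : ∀ x y, |f x - f y| ≤ A * ‖x - y‖) (r s : ℝ) (x y : Euc N) :
    |ballStep r f x - ballStep s f y| ≤ A * (‖x - y‖ + |r - s|) := by
  have key : ∀ r s : ℝ, 0 ≤ r → s ≤ 0 → ∀ x y : Euc N,
      |ballStep r f x - ballStep s f y| ≤ A * (‖x - y‖ + |r - s|) := by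
    intro r s hr hs x y
    have h1 := abs_ballStep_sub_of_nonneg hA hf hr le_rfl x y
    have h2 := abs_ballStep_sub_of_nonpos hA hf le_rfl hs y y
    have h3 := abs_sub_le (ballStep r f x) (ballStep 0 f y) (ballStep s f y)
    have h4 : |r - s| = |r - 0| + |0 - s| := by
      rw [abs_of_nonneg (by linarith), abs_of_nonneg (by linarith), abs_of_nonneg (by linarith)]
      ring
    rw [sub_self, norm_zero] at h2
    rw [h4]
    linarith
  rcases le_total 0 r with hr | hr <;> rcases le_total 0 s with hs | hs
  · exact abs_ballStep_sub_of_nonneg hA hf hr hs x y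
  · exact key r s hr hs x y
  · have := key s r hs hr y x
    rwa [abs_sub_comm, norm_sub_rev, abs_sub_comm s] at this
  · exact abs_ballStep_sub_of_nonpos hA hf hr hs x y

/-- The grid values of the explicit monotone scheme with time step `h` for `u_t = c |Du|`. -/
def gridValue {N : ℕ} (h : ℝ) (c : Euc N → ℝ → ℝ) (u0 : Euc N → ℝ) : ℕ → Euc N → ℝ
  | 0 => u0
  | k + 1 => fun x => ballStep (h * c x (k * h)) (gridValue h c u0 k) x

/-- The scheme extended to all times by a partial last step. -/
def schemeValue {N : ℕ} (h : ℝ) (c : Euc N → ℝ → ℝ) (u0 : Euc N → ℝ) (x : Euc N) (t : ℝ) : ℝ :=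
  ballStep ((t - (⌈t / h⌉₊ - 1 : ℕ) * h) * c x ((⌈t / h⌉₊ - 1 : ℕ) * h))
    (gridValue h c u0 (⌈t / h⌉₊ - 1)) x

lemma abs_ballStep_speed_sub_le {N : ℕ} {A s L τ : ℝ} {f : Euc N → ℝ} {c : Euc N → ℝ → ℝ}
    (hA : 0 ≤ A) (hs : 0 ≤ s) (hf : ∀ x y, |f x - f y| ≤ A * ‖x - y‖)
    (hc : ∀ x y, |c x τ - c y τ| ≤ L * ‖x - y‖) (x y : Euc N) :
    |ballStep (s * c x τ) f x - ballStep (s * c y τ) f y| ≤ A * Real.exp (L * s) * ‖x - y‖ := by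
  refine (abs_ballStep_sub_le hA hf _ _ x y).trans ?_
  rw [← mul_sub, abs_mul, abs_of_nonneg hs, mul_assoc]
  gcongr
  calc ‖x - y‖ + s * |c x τ - c y τ| ≤ ‖x - y‖ + s * (L * ‖x - y‖) := by gcongr; exact hc x y
    _ = (L * s + 1) * ‖x - y‖ := by ring
    _ ≤ _ := by gcongr; exact Real.add_one_le_exp _

lemma gridValue_lipschitz {N : ℕ} {h L K : ℝ} {c : Euc N → ℝ → ℝ} {u0 : Euc N → ℝ} (hh : 0 ≤ h)
    (hK : 0 ≤ K) (hc : ∀ t x y, |c x t - c y t| ≤ L * ‖x - y‖)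
    (hu0 : ∀ x y, |u0 x - u0 y| ≤ K * ‖x - y‖) (k : ℕ) (x y : Euc N) :
    |gridValue h c u0 k x - gridValue h c u0 k y| ≤ K * Real.exp (L * (k * h)) * ‖x - y‖ := by
  induction k generalizing x y with
  | zero => simpa [gridValue] using hu0 x y
  | succ k ih =>
    refine (abs_ballStep_speed_sub_le (by positivity) hh ih (hc (k * h)) x y).trans_eq ?_
    rw [mul_assoc K, ← Real.exp_add]
    push_cast
    ring_nf

lemma schemeValue_of_mem {N : ℕ} {h : ℝ} (hh : 0 < h) (c : Euc N → ℝ → ℝ) (u0 : Euc N → ℝ) (k : ℕ)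
    {t : ℝ} (ht : t ∈ Icc (k * h) ((k + 1 : ℕ) * h)) (x : Euc N) :
    schemeValue h c u0 x t = ballStep ((t - k * h) * c x (k * h)) (gridValue h c u0 k) x := by
  rcases ht.1.eq_or_lt with he | hlt
  · subst he
    have : (k : ℝ) * h / h = k := by field_simp
    rw [schemeValue, this, Nat.ceil_natCast, sub_self, zero_mul, ballStep_zero]
    cases k with
    | zero => simp [ballStep_zero]
    | succ k =>
      rw [Nat.add_sub_cancel]
      simp only [gridValue]
      congr 2
      push_cast
      ring
  · have : ⌈t / h⌉₊ = k + 1 := by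
      rw [Nat.ceil_eq_iff (by simp)]
      constructor
      · rw [Nat.add_sub_cancel, lt_div_iff₀ hh]; exact hlt
      · rw [div_le_iff₀ hh]; exact ht.2
    rw [schemeValue, this, Nat.add_sub_cancel]

lemma exists_mem_grid {h t : ℝ} (hh : 0 < h) (ht : 0 ≤ t) :
    ∃ k : ℕ, t ∈ Icc (k * h) ((k + 1 : ℕ) * h) := by
  refine ⟨⌊t / h⌋₊, ?_, ?_⟩
  · rw [← le_div_iff₀ hh]
    exact Nat.floor_le (by positivity)
  · rw [← div_le_iff₀ hh]
    push_cast
    exact (Nat.lt_floor_add_one _).le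

lemma exists_mem_grid_left {h t : ℝ} (hh : 0 < h) (ht : 0 < t) :
    ∃ k : ℕ, t ∈ Ioc (k * h) ((k + 1 : ℕ) * h) := by
  have hpos : 0 < ⌈t / h⌉₊ := Nat.ceil_pos.2 (by positivity)
  obtain ⟨k, hk⟩ := Nat.exists_eq_succ_of_ne_zero hpos.ne'
  have := (Nat.ceil_eq_iff (by simp)).1 hk
  refine ⟨k, ?_, ?_⟩
  · have := this.1
    rwa [Nat.succ_sub_one, lt_div_iff₀ hh] at this
  · rw [← div_le_iff₀ hh]
    exact this.2

/-- A function which is Lipschitz on each cell of a grid is Lipschitz. -/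
lemma abs_sub_le_of_grid {f : ℝ → ℝ} {h T L : ℝ} (hh : 0 < h)
    (hf : ∀ k : ℕ, ∀ a ∈ Icc 0 T ∩ Icc (k * h) ((k + 1 : ℕ) * h),
      ∀ b ∈ Icc 0 T ∩ Icc (k * h) ((k + 1 : ℕ) * h), |f a - f b| ≤ L * |a - b|)
    {a b : ℝ} (ha : a ∈ Icc 0 T) (hb : b ∈ Icc 0 T) : |f a - f b| ≤ L * |a - b| := by
  have key : ∀ k : ℕ, ∀ b ∈ Icc 0 T ∩ Icc (k * h) ((k + 1 : ℕ) * h), ∀ a ∈ Icc 0 b,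
      |f a - f b| ≤ L * |a - b| := by
    intro k
    induction k with
    | zero =>
      intro b hb a ha
      refine hf 0 a ⟨⟨ha.1, ha.2.trans hb.1.2⟩, ?_, ha.2.trans hb.2.2⟩ b hb
      simpa using ha.1
    | succ k ih =>
      intro b hb a ha
      rcases le_total ((k + 1 : ℕ) * h) a with hka | hka
      · exact hf _ a ⟨⟨ha.1, ha.2.trans hb.1.2⟩, hka, ha.2.trans hb.2.2⟩ b hb
      · have hm0 : (0 : ℝ) ≤ (k + 1 : ℕ) * h := by positivity
        have hmT : ((k + 1 : ℕ) * h : ℝ) ≤ T := hb.2.1.trans hb.1.2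
        have hmid : ((k + 1 : ℕ) * h : ℝ) ≤ ((k + 1 + 1 : ℕ) : ℝ) * h := by
          gcongr; simp
        have hmid' : (k * h : ℝ) ≤ (k + 1 : ℕ) * h := by
          gcongr; simp
        have h1 := ih _ ⟨⟨hm0, hmT⟩, hmid', le_rfl⟩ a ⟨ha.1, hka⟩
        have h2 := hf (k + 1) _ ⟨⟨hm0, hmT⟩, le_rfl, hmid⟩ b hb
        have h3 := abs_sub_le (f a) (f ((k + 1 : ℕ) * h)) (f b)
        have h4 : |a - b| = |a - (k + 1 : ℕ) * h| + |(k + 1 : ℕ) * h - b| := by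
          rw [abs_of_nonpos (by linarith [ha.2]), abs_of_nonpos (by linarith),
            abs_of_nonpos (by linarith [hb.2.1])]
          ring
        rw [h4]
        linarith
  rcases le_total a b with hab | hab
  · obtain ⟨k, hk⟩ := exists_mem_grid hh hb.1
    exact key k b ⟨hb, hk⟩ a ⟨ha.1, hab⟩
  · obtain ⟨k, hk⟩ := exists_mem_grid hh ha.1
    rw [abs_sub_comm, abs_sub_comm a]
    exact key k a ⟨ha, hk⟩ b ⟨hb.1, hab⟩

lemma schemeValue_zero {N : ℕ} {h : ℝ} (hh : 0 < h) (c : Euc N → ℝ → ℝ) (u0 : Euc N → ℝ)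
    (x : Euc N) : schemeValue h c u0 x 0 = u0 x := by
  rw [schemeValue_of_mem hh c u0 0 (by simp [hh.le])]
  simp [ballStep_zero, gridValue]

lemma schemeValue_lipschitz_space {N : ℕ} {h L K : ℝ} {c : Euc N → ℝ → ℝ} {u0 : Euc N → ℝ}
    (hh : 0 < h) (hK : 0 ≤ K) (hc : ∀ t x y, |c x t - c y t| ≤ L * ‖x - y‖)
    (hu0 : ∀ x y, |u0 x - u0 y| ≤ K * ‖x - y‖) {t : ℝ} (ht : 0 ≤ t) (x y : Euc N) :
    |schemeValue h c u0 x t - schemeValue h c u0 y t| ≤ K * Real.exp (L * t) * ‖x - y‖ := by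
  obtain ⟨k, hk⟩ := exists_mem_grid hh ht
  rw [schemeValue_of_mem hh c u0 k hk, schemeValue_of_mem hh c u0 k hk]
  refine (abs_ballStep_speed_sub_le (by positivity) (by linarith [hk.1])
    (gridValue_lipschitz hh.le hK hc hu0 k) (hc _) x y).trans_eq ?_
  rw [mul_assoc K, ← Real.exp_add]
  ring_nf

lemma schemeValue_lipschitz_time {N : ℕ} {h L M K T : ℝ} {c : Euc N → ℝ → ℝ} {u0 : Euc N → ℝ}
    (hh : 0 < h) (hK : 0 ≤ K) (hL : 0 ≤ L) (hc : ∀ t x y, |c x t - c y t| ≤ L * ‖x - y‖)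
    (hM : ∀ t x, |c x t| ≤ M)
    (hu0 : ∀ x y, |u0 x - u0 y| ≤ K * ‖x - y‖) (x : Euc N) {s t : ℝ} (hs : s ∈ Icc 0 T)
    (ht : t ∈ Icc 0 T) :
    |schemeValue h c u0 x s - schemeValue h c u0 x t| ≤ M * (Real.exp (L * T) * K) * |s - t| := by
  refine abs_sub_le_of_grid (f := schemeValue h c u0 x) hh ?_ hs ht
  intro k a ha b hb
  rw [schemeValue_of_mem hh c u0 k ha.2, schemeValue_of_mem hh c u0 k hb.2]
  refine (abs_ballStep_sub_le (by positivity) (gridValue_lipschitz hh.le hK hc hu0 k) _ _ x x).trans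
    ?_
  rw [sub_self, norm_zero, zero_add, ← sub_mul, sub_sub_sub_cancel_right, abs_mul]
  have hM0 : 0 ≤ M := (abs_nonneg _).trans (hM 0 x)
  calc K * Real.exp (L * (k * h)) * (|a - b| * |c x (k * h)|)
      ≤ K * Real.exp (L * T) * (|a - b| * M) := by
        gcongr
        · exact ha.2.1.trans ha.1.2
        · exact hM _ _
    _ = _ := by ring

lemma schemeValue_step {N : ℕ} {h : ℝ} (hh : 0 < h) (c : Euc N → ℝ → ℝ) (u0 : Euc N → ℝ) {t : ℝ}
    (ht : 0 < t) : ∃ s ∈ Ioc 0 h, s ≤ t ∧ ∀ x, schemeValue h c u0 x t =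
      ballStep (s * c x (t - s)) (fun y => schemeValue h c u0 y (t - s)) x := by
  obtain ⟨k, hk⟩ := exists_mem_grid_left hh ht
  have hkh : (0 : ℝ) ≤ k * h := by positivity
  have hkh' : (k * h : ℝ) ≤ (k + 1 : ℕ) * h := by gcongr; simp
  refine ⟨t - k * h, ⟨by linarith [hk.1], ?_⟩, by linarith, fun x => ?_⟩
  · have := hk.2
    push_cast at this
    linarith
  · rw [schemeValue_of_mem hh c u0 k (Ioc_subset_Icc_self hk), sub_sub_cancel]
    congr 1
    funext y
    rw [schemeValue_of_mem hh c u0 k ⟨le_rfl, hkh'⟩, sub_self, zero_mul, ballStep_zero]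

/-- Viscosity subsolutions of `u_t = c |Du|` on `ℝ^N × (0,T)`. -/
def IsViscositySubsolution (N : ℕ) (T : ℝ) (c u : Euc N → ℝ → ℝ) : Prop :=
  ∀ φ : Euc N × ℝ → ℝ, ContDiff ℝ 1 φ → ∀ x0 : Euc N, ∀ t0 ∈ Ioo 0 T,
    IsLocalMaxOn (fun p : Euc N × ℝ => u p.1 p.2 - φ p) (univ ×ˢ Icc 0 T) (x0, t0) →
    ∀ (p : Euc N) (q : ℝ), HasGradientAt (fun x => φ (x, t0)) p x0 →
      HasDerivAt (fun t => φ (x0, t)) q t0 → q ≤ c x0 t0 * ‖p‖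

lemma hasStrictFDerivAt_of_partial {N : ℕ} {φ : Euc N × ℝ → ℝ} (hφ : ContDiff ℝ 1 φ) {x0 p : Euc N}
    {t0 q : ℝ} (hp : HasGradientAt (fun x => φ (x, t0)) p x0)
    (hq : HasDerivAt (fun t => φ (x0, t)) q t0) :
    HasStrictFDerivAt φ ((innerSL ℝ p).comp (ContinuousLinearMap.fst ℝ (Euc N) ℝ) +
      q • ContinuousLinearMap.snd ℝ (Euc N) ℝ) (x0, t0) := by
  have hs := (hφ.contDiffAt (x := (x0, t0))).hasStrictFDerivAt (by simp)
  have h1 : HasFDerivAt (fun x => φ (x, t0)) ((fderiv ℝ φ (x0, t0)).comp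
      (ContinuousLinearMap.inl ℝ (Euc N) ℝ)) x0 :=
    HasFDerivAt.comp x0 (f := fun x => (x, t0)) hs.hasFDerivAt (hasFDerivAt_prodMk_left x0 t0)
  have h2 : HasFDerivAt (fun t => φ (x0, t)) ((fderiv ℝ φ (x0, t0)).comp
      (ContinuousLinearMap.inr ℝ (Euc N) ℝ)) t0 :=
    HasFDerivAt.comp t0 (f := fun t => (x0, t)) hs.hasFDerivAt (hasFDerivAt_prodMk_right x0 t0)
  have e1 := h1.unique hp.hasFDerivAt
  have e2 := h2.unique hq.hasFDerivAt
  have e : (innerSL ℝ p).comp (ContinuousLinearMap.fst ℝ (Euc N) ℝ) +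
      q • ContinuousLinearMap.snd ℝ (Euc N) ℝ = fderiv ℝ φ (x0, t0) := by
    ext v
    · have := DFunLike.congr_fun e1 v
      simpa using this.symm
    · have := DFunLike.congr_fun e2 1
      simpa using this.symm
  rw [e]
  exact hs

/-- Subsolution inequality for one step of the scheme, at a maximum point. -/
lemma deriv_le_of_ballStep {N : ℕ} {s γ M q ε ρ m : ℝ} {p x : Euc N} {f g : Euc N → ℝ}
    (hf : Continuous f) (hs : 0 < s) (hγ : |γ| ≤ M) (hε : 0 ≤ ε) (hρ : s * M ≤ ρ)
    (hm : ∀ z, ‖z - x‖ ≤ ρ → f z - g z ≤ ballStep (s * γ) f x - m)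
    (hg : ∀ z, ‖z - x‖ ≤ ρ → |m - g z - (inner ℝ p (x - z) + q * s)| ≤ ε * (‖z - x‖ + s)) :
    q ≤ γ * ‖p‖ + ε * (M + 1) := by
  have hM : s * |γ| ≤ s * M := by gcongr
  rcases le_or_gt 0 γ with h | h
  · obtain ⟨z, hz, he⟩ := exists_ballStep_eq hf (mul_nonneg hs.le h) x
    rw [abs_of_nonneg h] at hM hγ
    have h1 := hm z (hz.trans (hM.trans hρ))
    have h2 := (abs_le.1 (hg z (hz.trans (hM.trans hρ)))).1
    have h3 : |inner ℝ p (x - z)| ≤ ‖p‖ * (s * γ) :=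
      (abs_real_inner_le_norm _ _).trans (by rw [norm_sub_rev]; gcongr)
    have h4 : ε * (‖z - x‖ + s) ≤ ε * (s * M + s) := by gcongr; exact hz.trans hM
    have h5 := (abs_le.1 h3).1
    have : s * q ≤ s * (γ * ‖p‖ + ε * (M + 1)) := by
      nlinarith
    exact le_of_mul_le_mul_left this hs
  · rw [abs_of_neg h] at hM hγ
    obtain ⟨w, hw, hpw⟩ : ∃ w : Euc N, ‖w‖ ≤ 1 ∧ inner ℝ p w = ‖p‖ := by
      rcases eq_or_ne p 0 with rfl | hp
      · exact ⟨0, by simp, by simp⟩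
      · have : ‖p‖ ≠ 0 := norm_ne_zero_iff.2 hp
        refine ⟨‖p‖⁻¹ • p, ?_, ?_⟩
        · rw [norm_smul, norm_inv, norm_norm, inv_mul_cancel₀ this]
        · rw [inner_smul_right, real_inner_self_eq_norm_sq]
          field_simp
    have hr : 0 ≤ s * (-γ) := mul_nonneg hs.le (by linarith)
    have hz : ‖(x + (s * γ) • w) - x‖ ≤ s * (-γ) := by
      rw [add_sub_cancel_left, norm_smul, Real.norm_eq_abs, abs_of_nonpos (by linarith)]
      nlinarith [norm_nonneg w]
    have h0 := ballStep_le (r := s * γ) hf (by linarith) (hz.trans_eq (by ring))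
    have h1 := hm _ (hz.trans (hM.trans hρ))
    have h2 := (abs_le.1 (hg _ (hz.trans (hM.trans hρ)))).1
    have h4 : ε * (‖(x + (s * γ) • w) - x‖ + s) ≤ ε * (s * M + s) := by
      gcongr; exact hz.trans hM
    have h3 : inner ℝ p (x - (x + (s * γ) • w)) = - (s * γ * ‖p‖) := by
      rw [sub_add_cancel_left, inner_neg_right, inner_smul_right, hpw]
    rw [h3] at h2
    have : s * q ≤ s * (γ * ‖p‖ + ε * (M + 1)) := by
      nlinarith
    exact le_of_mul_le_mul_left this hs

lemma lipschitzOnWith_of_abs_sub_le {N : ℕ} {A T : ℝ} {f : Euc N → ℝ → ℝ} (hA : 0 ≤ A)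
    (hf : ∀ x y, ∀ s ∈ Icc 0 T, ∀ t ∈ Icc 0 T, |f x s - f y t| ≤ A * (‖x - y‖ + |s - t|)) :
    LipschitzOnWith (Real.toNNReal (A * 2)) (fun z : Euc N × ℝ => f z.1 z.2)
      (univ ×ˢ Icc 0 T) := by
  refine LipschitzOnWith.of_dist_le' fun y hy z hz => ?_
  have h1 := hf y.1 z.1 y.2 hy.2 z.2 hz.2
  have h2 : ‖y.1 - z.1‖ ≤ dist y z := by
    rw [← dist_eq_norm]; exact le_max_left _ _
  have h3 : |y.2 - z.2| ≤ dist y z := by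
    rw [← Real.dist_eq]; exact le_max_right _ _
  rw [Real.dist_eq]
  nlinarith

/-- Pointwise ultrafilter limits of equi-Lipschitz solutions of the scheme are viscosity
subsolutions. -/
lemma isViscositySubsolution_of_tendsto {N : ℕ} {T A M : ℝ} {c u : Euc N → ℝ → ℝ}
    {w : ℕ → Euc N → ℝ → ℝ} {h : ℕ → ℝ} {𝒰 : Ultrafilter ℕ}
    (hc : Continuous (fun p : Euc N × ℝ => c p.1 p.2)) (hM : ∀ t x, |c x t| ≤ M) (hM0 : 0 ≤ M)
    (hA : 0 ≤ A)
    (hlip : ∀ n x y, ∀ s ∈ Icc 0 T, ∀ t ∈ Icc 0 T,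
      |w n x s - w n y t| ≤ A * (‖x - y‖ + |s - t|))
    (hstep : ∀ n, ∀ t > 0, ∃ s ∈ Ioc 0 (h n), s ≤ t ∧ ∀ x,
      w n x t = ballStep (s * c x (t - s)) (fun y => w n y (t - s)) x)
    (hh : Tendsto h 𝒰 (𝓝 0)) (hu : ∀ x, ∀ t ∈ Icc 0 T, Tendsto (fun n => w n x t) 𝒰 (𝓝 (u x t))) :
    IsViscositySubsolution N T c u := by
  intro φ hφ x0 t0 ht0 hmax p q hp hq
  set ψ : Euc N × ℝ → ℝ := fun z => φ z + (‖z.1 - x0‖ ^ 2 + (z.2 - t0) ^ 2) with hψ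
  have hψc : ContDiff ℝ 1 ψ := by
    refine hφ.add (ContDiff.add ?_ ?_)
    · exact (contDiff_fst.sub contDiff_const).norm_sq ℝ
    · exact (contDiff_snd.sub contDiff_const).pow 2
  have hψp : HasGradientAt (fun x => ψ (x, t0)) p x0 := by
    have h1 : HasFDerivAt (fun x : Euc N => ‖x - x0‖ ^ 2) (0 : Euc N →L[ℝ] ℝ) x0 := by
      have := ((hasFDerivAt_id x0).sub_const x0).norm_sq
      simpa using this
    have h2 := (hp.hasFDerivAt.add h1).add_const ((t0 - t0) ^ 2)
    rw [add_zero] at h2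
    rw [hasGradientAt_iff_hasFDerivAt]
    refine h2.congr_of_eventuallyEq (Eventually.of_forall fun x => ?_)
    simp [hψ]
  have hψq : HasDerivAt (fun t => ψ (x0, t)) q t0 := by
    have h1 : HasDerivAt (fun t : ℝ => (t - t0) ^ 2) 0 t0 := by
      have := ((hasDerivAt_id t0).sub_const t0).fun_pow 2
      simpa using this
    have h2 := hq.add h1
    rw [add_zero] at h2
    refine h2.congr_of_eventuallyEq (Eventually.of_forall fun x => ?_)
    simp [hψ]
  have hψs := hasStrictFDerivAt_of_partial hψc hψp hψq
  obtain ⟨ρ, hρ, hball⟩ : ∃ ρ > 0, ∀ z ∈ closedBall (x0, t0) ρ, z.2 ∈ Icc 0 T ∧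
      u z.1 z.2 - φ z ≤ u x0 t0 - φ (x0, t0) := by
    have hnhds : univ ×ˢ Icc 0 T ∈ 𝓝 (x0, t0) :=
      prod_mem_nhds univ_mem (Icc_mem_nhds ht0.1 ht0.2)
    have h1 : ∀ᶠ z in 𝓝 (x0, t0), z.2 ∈ Icc 0 T ∧ u z.1 z.2 - φ z ≤ u x0 t0 - φ (x0, t0) := by
      have := hmax
      rw [IsLocalMaxOn, IsMaxFilter, nhdsWithin_eq_nhds.2 hnhds] at this
      filter_upwards [hnhds, this] with z hz hz'
      exact ⟨hz.2, hz'⟩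
    obtain ⟨ρ, hρ, hb⟩ := Metric.nhds_basis_closedBall.eventually_iff.1 h1
    exact ⟨ρ, hρ, fun z hz => hb hz⟩
  have hex : ∀ n, ∃ z ∈ closedBall (x0, t0) ρ, ∀ y ∈ closedBall (x0, t0) ρ,
      w n y.1 y.2 - ψ y ≤ w n z.1 z.2 - ψ z := by
    intro n
    have hcw := (lipschitzOnWith_of_abs_sub_le hA (hlip n)).continuousOn.mono
      (fun y hy => ⟨mem_univ y.1, (hball y hy).1⟩ : closedBall (x0, t0) ρ ⊆ univ ×ˢ Icc 0 T)
    obtain ⟨z, hz, hz'⟩ := (isCompact_closedBall (x0, t0) ρ).exists_isMaxOn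
      ⟨(x0, t0), mem_closedBall_self hρ.le⟩ (hcw.sub hψc.continuous.continuousOn)
    exact ⟨z, hz, fun y hy => hz' hy⟩
  choose z hzmem hzmax using hex
  obtain ⟨zl, hzlmem, hzl⟩ := (isCompact_closedBall (x0, t0) ρ).ultrafilter_le_nhds' (𝒰.map z)
    (by rw [Ultrafilter.mem_map]; exact Eventually.of_forall hzmem)
  have hzl' : Tendsto z 𝒰 (𝓝 zl) := hzl
  have hwz : Tendsto (fun n => w n (z n).1 (z n).2) 𝒰 (𝓝 (u zl.1 zl.2)) := by
    have h1 := hu zl.1 zl.2 (hball zl hzlmem).1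
    have h2 : Tendsto (fun n => A * (‖(z n).1 - zl.1‖ + |(z n).2 - zl.2|)) 𝒰 (𝓝 0) := by
      have : Continuous (fun y : Euc N × ℝ => A * (‖y.1 - zl.1‖ + |y.2 - zl.2|)) := by fun_prop
      have h := (this.tendsto zl).comp hzl'
      simpa [Function.comp_def] using h
    have h3 : Tendsto (fun n => w n (z n).1 (z n).2 - w n zl.1 zl.2) 𝒰 (𝓝 0) :=
      squeeze_zero_norm (fun n => hlip n _ _ _ (hball _ (hzmem n)).1 _ (hball _ hzlmem).1) h2
    simpa using h3.add h1
  have hzl0 : zl = (x0, t0) := by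
    have h1 : Tendsto (fun n => w n (z n).1 (z n).2 - ψ (z n)) 𝒰 (𝓝 (u zl.1 zl.2 - ψ zl)) :=
      hwz.sub ((hψc.continuous.tendsto zl).comp hzl')
    have h2 : Tendsto (fun n => w n x0 t0 - ψ (x0, t0)) 𝒰 (𝓝 (u x0 t0 - ψ (x0, t0))) :=
      (hu x0 t0 ⟨ht0.1.le, ht0.2.le⟩).sub_const _
    have h3 := le_of_tendsto_of_tendsto' h2 h1
      (fun n => hzmax n (x0, t0) (mem_closedBall_self hρ.le))
    have h4 := (hball zl hzlmem).2
    simp only [hψ, sub_self, norm_zero] at h3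
    have h5 : ‖zl.1 - x0‖ ^ 2 = 0 := by nlinarith [sq_nonneg ‖zl.1 - x0‖, sq_nonneg (zl.2 - t0)]
    have h6 : (zl.2 - t0) ^ 2 = 0 := by nlinarith [sq_nonneg ‖zl.1 - x0‖, sq_nonneg (zl.2 - t0)]
    have h7 : zl.1 = x0 := by simpa [sub_eq_zero] using h5
    have h8 : zl.2 = t0 := by simpa [sub_eq_zero] using h6
    exact Prod.ext h7 h8
  rw [hzl0] at hzl'
  refine le_of_forall_pos_le_add fun η hη => ?_
  set ε : ℝ := η / (M + 1 + ‖p‖) with hεdef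
  have hden : 0 < M + 1 + ‖p‖ := by positivity
  have hε : 0 < ε := by positivity
  obtain ⟨δ, hδ, hδ'⟩ : ∃ δ > 0, ∀ y ∈ ball (x0, t0) δ, |c y.1 y.2 - c x0 t0| ≤ ε ∧
      y ∈ closedBall (x0, t0) ρ ∧ ∀ y' ∈ ball (x0, t0) δ,
        |ψ y' - ψ y - (inner ℝ p (y'.1 - y.1) + q * (y'.2 - y.2))| ≤ ε * ‖y' - y‖ := by
    have h1 : ∀ᶠ y in 𝓝 (x0, t0), |c y.1 y.2 - c x0 t0| ≤ ε := by
      have := (hc.tendsto (x0, t0)).eventually (closedBall_mem_nhds (c x0 t0) hε)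
      filter_upwards [this] with y hy
      simpa [Real.dist_eq] using hy
    have h2 := closedBall_mem_nhds (x0, t0) hρ
    have h3 := (hasStrictFDerivAt_iff_isLittleO.1 hψs).def hε
    rw [nhds_prod_eq] at h3
    obtain ⟨δ1, hδ1, h3⟩ := (Metric.nhds_basis_ball.prod_self.eventually_iff).1 h3
    obtain ⟨δ2, hδ2, h4⟩ := Metric.nhds_basis_ball.eventually_iff.1 (h1.and h2)
    refine ⟨min δ1 δ2, lt_min hδ1 hδ2, fun y hy => ?_⟩
    have hy1 := ball_subset_ball (min_le_left δ1 δ2) hy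
    have hy2 := h4 (ball_subset_ball (min_le_right δ1 δ2) hy)
    refine ⟨hy2.1, hy2.2, fun y' hy' => ?_⟩
    have hy'1 := ball_subset_ball (min_le_left δ1 δ2) hy'
    have := h3 (Set.mk_mem_prod hy'1 hy1)
    simpa [Real.norm_eq_abs] using this
  have hev1 : ∀ᶠ n in (𝒰 : Filter ℕ), z n ∈ ball (x0, t0) (δ / 2) :=
    hzl'.eventually (ball_mem_nhds _ (by positivity))
  have hev2 : ∀ᶠ n in (𝒰 : Filter ℕ), h n * (M + 1) < δ / 2 := by
    have := hh.mul_const (M + 1)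
    rw [zero_mul] at this
    exact this.eventually_lt_const (by positivity)
  have hev3 : ∀ᶠ n in (𝒰 : Filter ℕ), 0 < (z n).2 :=
    ((continuous_snd.tendsto _).comp hzl').eventually_const_lt ht0.1
  obtain ⟨n, hn1, hn2, hn3⟩ := (hev1.and (hev2.and hev3)).exists
  obtain ⟨s, hs, hst, hw⟩ := hstep n (z n).2 hn3
  have hsh : s * (M + 1) < δ / 2 := by
    have : s * (M + 1) ≤ h n * (M + 1) := by gcongr; exact hs.2
    exact this.trans_lt hn2
  have hsδ : s < δ / 2 := by nlinarith [hs.1]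
  have hsMδ : s * M < δ / 2 := by nlinarith [hs.1]
  have hzn1 : dist (z n).1 x0 < δ / 2 := (le_max_left _ _).trans_lt hn1
  have hzn2 : dist (z n).2 t0 < δ / 2 := (le_max_right _ _).trans_lt hn1
  have hnear : ∀ y, ‖y - (z n).1‖ ≤ s * M → (y, (z n).2 - s) ∈ ball (x0, t0) δ := by
    intro y hy
    rw [mem_ball, Prod.dist_eq, max_lt_iff]
    constructor
    · have := dist_triangle y (z n).1 x0
      rw [dist_eq_norm y (z n).1] at this
      dsimp only
      linarith
    · dsimp only
      rw [Real.dist_eq] at hzn2 ⊢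
      rw [abs_lt] at hzn2 ⊢
      constructor <;> linarith [hs.1]
  have hznδ : z n ∈ ball (x0, t0) δ := ball_subset_ball (by linarith) hn1
  have hstart : (z n).2 - s ∈ Icc 0 T :=
    (hball _ (hδ' _ (hnear (z n).1 (by simpa using mul_nonneg hs.1.le hM0))).2.1).1
  have hfc : Continuous (fun y => w n y ((z n).2 - s)) :=
    continuous_of_abs_sub_le (A := A) (fun x y => by
      simpa using hlip n x y _ hstart _ hstart)
  have hmain := deriv_le_of_ballStep (q := q) (p := p) (ε := ε) (x := (z n).1) (m := ψ (z n))
    (g := fun y => ψ (y, (z n).2 - s)) hfc hs.1 (hM ((z n).2 - s) (z n).1) hε.le le_rfl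
    (fun y hy => by
      rw [← hw]
      exact hzmax n _ (hδ' _ (hnear y hy)).2.1)
    (fun y hy => by
      have h1 := (hδ' _ (hnear y hy)).2.2 _ hznδ
      rw [sub_sub_cancel] at h1
      refine h1.trans ?_
      gcongr
      rw [Prod.norm_def]
      refine max_le ?_ ?_
      · rw [Prod.fst_sub, norm_sub_rev]
        linarith [hs.1]
      · rw [Prod.snd_sub, sub_sub_cancel, Real.norm_of_nonneg hs.1.le]
        linarith [norm_nonneg (y - (z n).1)])
  have hcz := (abs_le.1 (hδ' _ (hnear (z n).1 (by simpa using mul_nonneg hs.1.le hM0))).1).2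
  dsimp only at hcz
  have hfin : c (z n).1 ((z n).2 - s) * ‖p‖ ≤ (c x0 t0 + ε) * ‖p‖ := by
    gcongr; linarith
  have hε' : ε * (M + 1 + ‖p‖) = η := by rw [hεdef]; field_simp
  nlinarith

lemma IsViscositySubsolution.quadratic_test {N : ℕ} {T a β l B : ℝ} {n : ℕ} {c u : Euc N → ℝ → ℝ}
    (hu : IsViscositySubsolution N T c u) (hT : 0 < T) (hB : 0 ≤ B) {x0 y : Euc N} {t0 s : ℝ}
    (ht0 : t0 ∈ Ioo 0 T)
    (hmax : ∀ x, ∀ t ∈ Icc 0 T,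
      u x t - (a * (‖x - y‖ ^ 2 + (t - s) ^ 2) + β * ‖x‖ ^ 2 + (l * t + B * (t / T) ^ n)) ≤
      u x0 t0 - (a * (‖x0 - y‖ ^ 2 + (t0 - s) ^ 2) + β * ‖x0‖ ^ 2 +
        (l * t0 + B * (t0 / T) ^ n))) :
    2 * a * (t0 - s) + l ≤ c x0 t0 * ‖(2 * a) • (x0 - y) + (2 * β) • x0‖ := by
  set φ : Euc N × ℝ → ℝ := fun z =>
    a * (‖z.1 - y‖ ^ 2 + (z.2 - s) ^ 2) + β * ‖z.1‖ ^ 2 + (l * z.2 + B * (z.2 / T) ^ n) with hφ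
  have hφc : ContDiff ℝ 1 φ := by
    have h1 : ContDiff ℝ 1 (fun z : Euc N × ℝ => ‖z.1 - y‖ ^ 2) :=
      (contDiff_fst.sub contDiff_const).norm_sq ℝ
    have h2 : ContDiff ℝ 1 (fun z : Euc N × ℝ => ‖z.1‖ ^ 2) := contDiff_fst.norm_sq ℝ
    fun_prop
  have hp : HasGradientAt (fun x => φ (x, t0)) ((2 * a) • (x0 - y) + (2 * β) • x0) x0 := by
    rw [hasGradientAt_iff_hasFDerivAt]
    have h1 := ((hasFDerivAt_id (𝕜 := ℝ) x0).sub_const y).norm_sq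
    have h2 := (hasFDerivAt_id (𝕜 := ℝ) x0).norm_sq
    have h3 := (((h1.add_const ((t0 - s) ^ 2)).const_mul a).add (h2.const_mul β)).add_const
      (l * t0 + B * (t0 / T) ^ n)
    refine HasFDerivAt.congr_fderiv h3 ?_
    ext v
    simp
    ring
  have hq : HasDerivAt (fun t => φ (x0, t))
      (2 * a * (t0 - s) + (l + B * (n * (t0 / T) ^ (n - 1) * (1 / T)))) t0 := by
    have h1 := ((hasDerivAt_id t0).sub_const s).fun_pow 2
    have h2 := ((hasDerivAt_id t0).div_const T).fun_pow n
    have h3 := (((h1.const_add (‖x0 - y‖ ^ 2)).const_mul a).add_const (β * ‖x0‖ ^ 2)).add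
      (((hasDerivAt_id t0).const_mul l).add (h2.const_mul B))
    refine HasDerivAt.congr_deriv h3 ?_
    simp
    ring
  have hloc : IsLocalMaxOn (fun p : Euc N × ℝ => u p.1 p.2 - φ p) (univ ×ˢ Icc 0 T) (x0, t0) :=
    eventually_nhdsWithin_of_forall fun z hz => hmax z.1 z.2 hz.2
  have h := hu φ hφc x0 t0 ht0 hloc _ _ hp hq
  have hpos : 0 ≤ B * (n * (t0 / T) ^ (n - 1) * (1 / T)) := by
    have : 0 ≤ t0 / T := div_nonneg ht0.1.le hT.le
    positivity
  linarith

lemma penalized_slope_le {N : ℕ} {A a β : ℝ} {x y : Euc N} (hβ : 0 ≤ β) (hA : 0 ≤ A)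
    (h : a * ‖x - y‖ ^ 2 + β * ‖x‖ ^ 2 ≤ A * ‖x - y‖ + β * ‖y‖ ^ 2) (hx : β * ‖x‖ ≤ 1)
    (hy : β * ‖y‖ ≤ 1) : a * ‖x - y‖ ≤ A + 2 := by
  rcases (norm_nonneg (x - y)).eq_or_lt with h0 | h0
  · rw [← h0, mul_zero]
    positivity
  have h3 : ‖y‖ - ‖x‖ ≤ ‖x - y‖ := by
    rw [norm_sub_rev]; exact norm_sub_norm_le y x
  have h4 : β * ‖y‖ ^ 2 - β * ‖x‖ ^ 2 ≤ 2 * ‖x - y‖ := by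
    have h5 : β * ‖y‖ ^ 2 - β * ‖x‖ ^ 2 = (β * ‖y‖ + β * ‖x‖) * (‖y‖ - ‖x‖) := by ring
    rw [h5]
    have h6 : 0 ≤ β * ‖y‖ + β * ‖x‖ := by positivity
    calc (β * ‖y‖ + β * ‖x‖) * (‖y‖ - ‖x‖) ≤ (β * ‖y‖ + β * ‖x‖) * ‖x - y‖ := by gcongr
      _ ≤ 2 * ‖x - y‖ := by gcongr; linarith
  have h5 : ‖x - y‖ * (a * ‖x - y‖) ≤ ‖x - y‖ * (A + 2) := by linarith
  exact le_of_mul_le_mul_left h5 h0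

lemma continuous_doubling_penalty {N : ℕ} (a β l B T : ℝ) (n : ℕ) :
    Continuous (fun z : (Euc N × ℝ) × (Euc N × ℝ) =>
      a * (‖z.1.1 - z.2.1‖ ^ 2 + (z.1.2 - z.2.2) ^ 2) + β * ‖z.1.1‖ ^ 2 + β * ‖z.2.1‖ ^ 2
        + (l * z.1.2 + B * (z.1.2 / T) ^ n) + (l * z.2.2 + B * (z.2.2 / T) ^ n)) := by
  fun_prop

set_option maxHeartbeats 1600000 in
/-- Comparison for Lipschitz continuous sub- and supersolutions (the supersolution is `-w`). -/
lemma IsViscositySubsolution.add_nonpos {N : ℕ} {T A M : ℝ} {c u w : Euc N → ℝ → ℝ} (hT : 0 < T)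
    (hc : ContinuousOn (fun p : Euc N × ℝ => c p.1 p.2) (univ ×ˢ Icc 0 T))
    (hM : ∀ t ∈ Icc 0 T, ∀ x, |c x t| ≤ M) (hM0 : 0 < M) (hA : 0 ≤ A)
    (hu : IsViscositySubsolution N T c u) (hw : IsViscositySubsolution N T (fun x t => -c x t) w)
    (hul : ∀ x y, ∀ s ∈ Icc 0 T, ∀ t ∈ Icc 0 T, |u x s - u y t| ≤ A * (‖x - y‖ + |s - t|))
    (hwl : ∀ x y, ∀ s ∈ Icc 0 T, ∀ t ∈ Icc 0 T, |w x s - w y t| ≤ A * (‖x - y‖ + |s - t|))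
    (h0 : ∀ x, u x 0 + w x 0 ≤ 0) (x' : Euc N) {t' : ℝ} (ht' : t' ∈ Ioo 0 T) :
    u x' t' + w x' t' ≤ 0 := by
  by_contra! hd
  set d := u x' t' + w x' t'
  have hzero : (0 : ℝ) ∈ Icc 0 T := ⟨le_rfl, hT.le⟩
  set M0 := 2 * A * T + A ^ 2 / 2 with hM0def
  have hM0' : 0 ≤ M0 := by positivity
  set B := M0 + 1
  have hB : 0 < B := by positivity
  obtain ⟨n, hn⟩ : ∃ n : ℕ, (t' / T) ^ n < d / (16 * B) :=
    exists_pow_lt_of_lt_one (by positivity) ((div_lt_one hT).2 ht'.2)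
  have hn' : 2 * (B * (t' / T) ^ n) ≤ d / 8 := by
    rw [lt_div_iff₀ (by positivity)] at hn
    linarith
  set l := d / (8 * T) with hl
  have hl0 : 0 < l := by positivity
  have hlt : 2 * (l * t') ≤ d / 4 := by
    have h1 : l * t' ≤ l * T := by gcongr; exact ht'.2.le
    have h2 : l * T = d / 8 := by rw [hl]; field_simp
    linarith
  set κ := min 1 (l / (8 * M)) with hκ
  have hκ0 : 0 < κ := lt_min one_pos (by positivity)
  have hκM : 4 * M * κ ≤ l / 2 := by
    have h1 : κ ≤ l / (8 * M) := min_le_right _ _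
    rw [le_div_iff₀ (by positivity)] at h1
    linarith
  set β := min (κ ^ 2 / (M0 + 1)) (d / (16 * (‖x'‖ ^ 2 + 1))) with hβ
  have hβ0 : 0 < β := lt_min (by positivity) (by positivity)
  have hβM : β * M0 ≤ κ ^ 2 := by
    have h1 : β ≤ κ ^ 2 / (M0 + 1) := min_le_left _ _
    rw [le_div_iff₀ (by positivity)] at h1
    linarith
  have hβx : 2 * (β * ‖x'‖ ^ 2) ≤ d / 8 := by
    have h1 : β ≤ d / (16 * (‖x'‖ ^ 2 + 1)) := min_le_right _ _
    rw [le_div_iff₀ (by positivity)] at h1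
    linarith
  set R := Real.sqrt (M0 / β) with hR
  have hR2 : R ^ 2 = M0 / β := Real.sq_sqrt (by positivity)
  set η := l / (4 * (A + 2)) with hη
  have hη0 : 0 < η := by positivity
  have hηA : η * (2 * (A + 2)) = l / 2 := by rw [hη]; field_simp; ring
  have hKc : IsCompact (closedBall (0 : Euc N) R ×ˢ Icc 0 T) :=
    (isCompact_closedBall _ _).prod isCompact_Icc
  obtain ⟨δ, hδ, huc⟩ := Metric.uniformContinuousOn_iff.1
    (hKc.uniformContinuousOn_of_continuous (hc.mono (prod_mono (subset_univ _) subset_rfl))) η hη0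
  set a := 1 + A ^ 2 / d + (2 * M0 + 1) / δ ^ 2 with ha
  have ha1 : 1 ≤ a := by
    have h1 : 0 ≤ A ^ 2 / d := by positivity
    have h2 : 0 ≤ (2 * M0 + 1) / δ ^ 2 := by positivity
    linarith
  have ha0 : 0 < a := by linarith
  have haA : A ^ 2 < a * d := by
    have h1 : (1 + A ^ 2 / d) * d = d + A ^ 2 := by field_simp
    have h2 : 0 ≤ (2 * M0 + 1) / δ ^ 2 * d := by positivity
    rw [ha, add_mul, h1]
    linarith
  have haδ : 2 * M0 < a * δ ^ 2 := by
    have h1 : (2 * M0 + 1) / δ ^ 2 * δ ^ 2 = 2 * M0 + 1 := by field_simp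
    have h2 : 0 ≤ (1 + A ^ 2 / d) * δ ^ 2 := by positivity
    rw [ha, add_mul, h1]
    linarith
  set g : ℝ → ℝ := fun t => l * t + B * (t / T) ^ n with hg
  have hg0 : ∀ t ∈ Icc 0 T, 0 ≤ g t := by
    intro t ht
    have : 0 ≤ t / T := div_nonneg ht.1 hT.le
    have := ht.1
    simp only [hg]
    positivity
  have hgT : B ≤ g T := by
    simp only [hg, div_self hT.ne', one_pow, mul_one]
    have : 0 ≤ l * T := by positivity
    linarith
  set Φ : (Euc N × ℝ) × (Euc N × ℝ) → ℝ := fun z =>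
    u z.1.1 z.1.2 + w z.2.1 z.2.2 - a * (‖z.1.1 - z.2.1‖ ^ 2 + (z.1.2 - z.2.2) ^ 2)
      - β * ‖z.1.1‖ ^ 2 - β * ‖z.2.1‖ ^ 2 - g z.1.2 - g z.2.2 with hΦ
  have hbound : ∀ x y, ∀ t ∈ Icc 0 T, ∀ s ∈ Icc 0 T, Φ ((x, t), (y, s)) ≤
      M0 - a / 2 * ‖x - y‖ ^ 2 - a * (t - s) ^ 2 - β * ‖x‖ ^ 2 - β * ‖y‖ ^ 2 - g t - g s := by
    intro x y t ht s hs
    have h1 := (abs_le.1 (hul x y t ht 0 hzero)).2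
    have h2 := (abs_le.1 (hwl y y s hs 0 hzero)).2
    rw [sub_zero, abs_of_nonneg ht.1] at h1
    rw [sub_self, norm_zero, sub_zero, zero_add, abs_of_nonneg hs.1] at h2
    have h3 : A * t ≤ A * T := by gcongr; exact ht.2
    have h4 : A * s ≤ A * T := by gcongr; exact hs.2
    have h5 : A * ‖x - y‖ ≤ A ^ 2 / 2 + ‖x - y‖ ^ 2 / 2 := by
      linarith [sq_nonneg (A - ‖x - y‖)]
    have h6 : ‖x - y‖ ^ 2 / 2 ≤ a / 2 * ‖x - y‖ ^ 2 := by
      linarith [mul_le_mul_of_nonneg_right ha1 (sq_nonneg ‖x - y‖)]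
    simp only [hΦ]
    linarith [h0 y]
  have hΦc : ContinuousOn Φ
      ((closedBall (0 : Euc N) R ×ˢ Icc 0 T) ×ˢ (closedBall (0 : Euc N) R ×ˢ Icc 0 T)) := by
    have h1 := (lipschitzOnWith_of_abs_sub_le hA hul).continuousOn.comp continuousOn_fst
      (s := (closedBall (0 : Euc N) R ×ˢ Icc 0 T) ×ˢ (closedBall (0 : Euc N) R ×ˢ Icc 0 T))
      (fun z hz => ⟨mem_univ _, hz.1.2⟩)
    have h2 := (lipschitzOnWith_of_abs_sub_le hA hwl).continuousOn.comp continuousOn_snd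
      (s := (closedBall (0 : Euc N) R ×ˢ Icc 0 T) ×ˢ (closedBall (0 : Euc N) R ×ˢ Icc 0 T))
      (fun z hz => ⟨mem_univ _, hz.2.2⟩)
    have h3 := continuous_doubling_penalty (N := N) a β l B T n
    refine ((h1.add h2).sub h3.continuousOn).congr fun z _ => ?_
    simp only [hΦ, hg, Function.comp, Pi.add_apply, Pi.sub_apply]
    ring
  have hR0 : 0 ≤ R := Real.sqrt_nonneg _
  have hne : ((closedBall (0 : Euc N) R ×ˢ Icc 0 T) ×ˢ
      (closedBall (0 : Euc N) R ×ˢ Icc 0 T)).Nonempty :=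
    ⟨((0, 0), (0, 0)), ⟨⟨mem_closedBall_self hR0, hzero⟩, ⟨mem_closedBall_self hR0, hzero⟩⟩⟩
  obtain ⟨⟨⟨x, t⟩, ⟨y, s⟩⟩, hmem, hmaxK⟩ := (hKc.prod hKc).exists_isMaxOn hne hΦc
  have hstart : d / 2 ≤ Φ ((x', t'), (x', t')) := by
    simp only [hΦ, hg, sub_self, norm_zero]
    linarith
  have hinball : ∀ x y, ∀ t ∈ Icc 0 T, ∀ s ∈ Icc 0 T, 0 < Φ ((x, t), (y, s)) →
      x ∈ closedBall (0 : Euc N) R ∧ y ∈ closedBall (0 : Euc N) R ∧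
      β * ‖x‖ ^ 2 ≤ M0 ∧ β * ‖y‖ ^ 2 ≤ M0 ∧ a * ‖x - y‖ ^ 2 ≤ 2 * M0 ∧ a * (t - s) ^ 2 ≤ 2 * M0 := by
    intro x y t ht s hs hpos
    have hb := hbound x y t ht s hs
    have e1 : 0 ≤ a * ‖x - y‖ ^ 2 := by positivity
    have e2 : 0 ≤ a * (t - s) ^ 2 := by positivity
    have e3 : 0 ≤ β * ‖x‖ ^ 2 := by positivity
    have e4 : 0 ≤ β * ‖y‖ ^ 2 := by positivity
    have e5 := hg0 t ht
    have e6 := hg0 s hs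
    have hx : β * ‖x‖ ^ 2 ≤ M0 := by linarith
    have hy : β * ‖y‖ ^ 2 ≤ M0 := by linarith
    have hball : ∀ v : Euc N, β * ‖v‖ ^ 2 ≤ M0 → v ∈ closedBall (0 : Euc N) R := by
      intro v hv
      rw [mem_closedBall, dist_zero_right]
      refine abs_le_of_sq_le_sq' ?_ hR0 |>.2
      rw [hR2, le_div_iff₀ hβ0]
      linarith
    exact ⟨hball x hx, hball y hy, hx, hy, by linarith, by linarith⟩
  have hmax : ∀ x1 y1, ∀ t1 ∈ Icc 0 T, ∀ s1 ∈ Icc 0 T,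
      Φ ((x1, t1), (y1, s1)) ≤ Φ ((x, t), (y, s)) := by
    have hpos : ∀ x1 y1, ∀ t1 ∈ Icc 0 T, ∀ s1 ∈ Icc 0 T, 0 < Φ ((x1, t1), (y1, s1)) →
        Φ ((x1, t1), (y1, s1)) ≤ Φ ((x, t), (y, s)) := by
      intro x1 y1 t1 ht1 s1 hs1 hp
      have := hinball x1 y1 t1 ht1 s1 hs1 hp
      exact hmaxK ⟨⟨this.1, ht1⟩, ⟨this.2.1, hs1⟩⟩
    have h1 := hpos x' x' t' ⟨ht'.1.le, ht'.2.le⟩ t' ⟨ht'.1.le, ht'.2.le⟩ (by linarith)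
    intro x1 y1 t1 ht1 s1 hs1
    rcases lt_or_ge 0 (Φ ((x1, t1), (y1, s1))) with hp | hp
    · exact hpos x1 y1 t1 ht1 s1 hs1 hp
    · linarith
  have htI : t ∈ Icc 0 T := hmem.1.2
  have hsI : s ∈ Icc 0 T := hmem.2.2
  have hΦd : d / 2 ≤ Φ ((x, t), (y, s)) :=
    hstart.trans (hmax _ _ _ ⟨ht'.1.le, ht'.2.le⟩ _ ⟨ht'.1.le, ht'.2.le⟩)
  obtain ⟨hxR, hyR, hβxM, hβyM, hxy, hts⟩ := hinball x y t htI s hsI (by linarith)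
  have hbd := hbound x y t htI s hsI
  have e1 : 0 ≤ a * ‖x - y‖ ^ 2 := by positivity
  have e2 : 0 ≤ a * (t - s) ^ 2 := by positivity
  have e3 : 0 ≤ β * ‖x‖ ^ 2 := by positivity
  have e4 : 0 ≤ β * ‖y‖ ^ 2 := by positivity
  have e5 := hg0 t htI
  have e6 := hg0 s hsI
  have hquad : ∀ r : ℝ, A * r - a * r ^ 2 < d / 4 := by
    intro r
    have h1 : a * (A * r - a * r ^ 2) < a * (d / 4) := by
      linarith [sq_nonneg (A - 2 * a * r)]
    exact lt_of_mul_lt_mul_left h1 ha0.le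
  have hgt : g t < B := by linarith
  have hgs : g s < B := by linarith
  have ht : t ∈ Ioo 0 T := by
    refine ⟨htI.1.lt_of_ne fun h => ?_, htI.2.lt_of_ne fun h => ?_⟩
    · have h1 := (abs_le.1 (hwl y x s hsI 0 hzero)).2
      rw [sub_zero, abs_of_nonneg hsI.1, norm_sub_rev] at h1
      have h2 := hquad ‖x - y‖
      have h3 := hquad s
      have h4 := h0 x
      simp only [hΦ, ← h, zero_sub, neg_sq] at hΦd
      rw [← h] at e5
      linarith
    · rw [h] at hgt
      linarith
  have hs : s ∈ Ioo 0 T := by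
    refine ⟨hsI.1.lt_of_ne fun h => ?_, hsI.2.lt_of_ne fun h => ?_⟩
    · have h1 := (abs_le.1 (hul x y t htI 0 hzero)).2
      rw [sub_zero, abs_of_nonneg htI.1] at h1
      have h2 := hquad ‖x - y‖
      have h3 := hquad t
      have h4 := h0 y
      simp only [hΦ, ← h, sub_zero] at hΦd
      rw [← h] at e6
      linarith
    · rw [h] at hgs
      linarith
  have hU := hu.quadratic_test (a := a) (β := β) (l := l) (B := B) (n := n) (x0 := x) (y := y)
    (s := s) hT hB.le ht (fun x1 t1 ht1 => by
      have := hmax x1 y t1 ht1 s hsI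
      simp only [hΦ, hg] at this
      linarith)
  have hW := hw.quadratic_test (a := a) (β := β) (l := l) (B := B) (n := n) (x0 := y) (y := x)
    (s := t) hT hB.le hs (fun y1 s1 hs1 => by
      have := hmax x y1 t htI s1 hs1
      simp only [hΦ, hg, norm_sub_rev x, sub_sq_comm t] at this
      linarith)
  have hκn : ∀ v : Euc N, β * ‖v‖ ^ 2 ≤ M0 → β * ‖v‖ ≤ κ := by
    intro v hv
    refine abs_le_of_sq_le_sq' ?_ hκ0.le |>.2
    calc (β * ‖v‖) ^ 2 = β * (β * ‖v‖ ^ 2) := by ring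
      _ ≤ β * M0 := by gcongr
      _ ≤ κ ^ 2 := hβM
  have hκx := hκn x hβxM
  have hκy := hκn y hβyM
  have hκ1 : κ ≤ 1 := min_le_left _ _
  set P := (2 * a) • (x - y) with hP
  have hPn : ‖P‖ = 2 * (a * ‖x - y‖) := by
    rw [hP, norm_smul, Real.norm_of_nonneg (by positivity)]; ring
  have hPA : ‖P‖ ≤ 2 * (A + 2) := by
    rw [hPn]
    have h1 := hmax y y t htI s hsI
    have h2 := (abs_le.1 (hul x y t htI t htI)).2
    simp only [hΦ, sub_self, norm_zero, abs_zero, add_zero] at h1 h2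
    have := penalized_slope_le (A := A) (a := a) (x := x) (y := y) hβ0.le hA (by linarith)
      (hκx.trans hκ1) (hκy.trans hκ1)
    linarith
  have hn1 : |‖P + (2 * β) • x‖ - ‖P‖| ≤ 2 * κ := by
    refine (abs_norm_sub_norm_le _ _).trans ?_
    rw [add_sub_cancel_left, norm_smul, Real.norm_of_nonneg (by positivity)]
    linarith
  have hn2 : |‖(2 * a) • (y - x) + (2 * β) • y‖ - ‖P‖| ≤ 2 * κ := by
    have : ‖P‖ = ‖(2 * a) • (y - x)‖ := by rw [hP, norm_smul, norm_smul, norm_sub_rev]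
    rw [this]
    refine (abs_norm_sub_norm_le _ _).trans ?_
    rw [add_sub_cancel_left, norm_smul, Real.norm_of_nonneg (by positivity)]
    linarith
  have hcc : c x t - c y s ≤ η := by
    have hsmall : ∀ r : ℝ, 0 ≤ r → a * r ^ 2 ≤ 2 * M0 → r < δ := by
      intro r hr h
      refine abs_lt_of_sq_lt_sq' ?_ hδ.le |>.2
      exact lt_of_mul_lt_mul_left (h.trans_lt haδ) ha0.le
    have := huc (x, t) ⟨hxR, htI⟩ (y, s) ⟨hyR, hsI⟩ (by
      rw [Prod.dist_eq, max_lt_iff, dist_eq_norm, Real.dist_eq]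
      exact ⟨hsmall _ (norm_nonneg _) hxy, hsmall _ (abs_nonneg _) (by rwa [sq_abs])⟩)
    rw [Real.dist_eq] at this
    exact (abs_lt.1 this).2.le
  have hm1 : c x t * (‖P + (2 * β) • x‖ - ‖P‖) ≤ M * (2 * κ) := by
    refine (le_abs_self _).trans ?_
    rw [abs_mul]
    gcongr
    exact hM t htI x
  have hm2 : -c y s * (‖(2 * a) • (y - x) + (2 * β) • y‖ - ‖P‖) ≤ M * (2 * κ) := by
    refine (le_abs_self _).trans ?_
    rw [abs_mul, abs_neg]
    gcongr
    exact hM s hsI y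
  have hm3 : (c x t - c y s) * ‖P‖ ≤ η * (2 * (A + 2)) := by gcongr
  linarith

lemma IsViscositySubsolution.congr_speed {N : ℕ} {T : ℝ} {c c' u : Euc N → ℝ → ℝ}
    (hu : IsViscositySubsolution N T c u) (h : ∀ x, ∀ t ∈ Ioo 0 T, c x t = c' x t) :
    IsViscositySubsolution N T c' u := by
  intro φ hφ x0 t0 ht0 hmax p q hp hq
  rw [← h x0 t0 ht0]
  exact hu φ hφ x0 t0 ht0 hmax p q hp hq

/-- A viscosity solution is a function which, together with its opposite, is a subsolution. -/
lemma isViscositySolution_iff {N : ℕ} {T : ℝ} {c u : Euc N → ℝ → ℝ} {u0 : Euc N → ℝ} :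
    IsViscositySolution N T c u u0 ↔ (∀ x, u x 0 = u0 x) ∧ IsViscositySubsolution N T c u ∧
      IsViscositySubsolution N T (fun x t => -c x t) (fun x t => -u x t) := by
  refine and_congr_right fun _ => ⟨fun h => ⟨?_, ?_⟩, fun ⟨h1, h2⟩ => ?_⟩
  · intro φ hφ x0 t0 ht0 hmax p q hp hq
    have := (h (fun x t => φ (x, t)) hφ x0 t0 ht0).1 hmax
    rwa [hp.gradient, hq.deriv] at this
  · intro φ hφ x0 t0 ht0 hmax p q hp hq
    have := (h (fun x t => -φ (x, t)) hφ.neg x0 t0 ht0).2 (by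
      refine hmax.neg.congr (Eventually.of_forall fun z => ?_) ?_ <;>
        simp [sub_eq_add_neg, add_comm]
      exact ⟨ht0.1.le, ht0.2.le⟩)
    have hp' : HasGradientAt (fun x => -φ (x, t0)) (-p) x0 := by
      rw [hasGradientAt_iff_hasFDerivAt, map_neg]
      exact hp.hasFDerivAt.neg
    rw [hp'.gradient, norm_neg, hq.fun_neg.deriv] at this
    linarith
  · intro φ hφ x0 t0 ht0
    have hd : Differentiable ℝ (fun p : Euc N × ℝ => φ p.1 p.2) := hφ.differentiable (by simp)
    have hp : HasGradientAt (fun x => φ x t0) (gradient (fun x => φ x t0) x0) x0 :=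
      (hd.comp (differentiable_id.prodMk (differentiable_const t0)) x0).hasGradientAt
    have hq : HasDerivAt (φ x0) (deriv (φ x0) t0) t0 :=
      (hd.comp ((differentiable_const x0).prodMk differentiable_id) t0).hasDerivAt
    refine ⟨fun hmax => h1 _ hφ x0 t0 ht0 hmax _ _ hp hq, fun hmin => ?_⟩
    have hp' : HasGradientAt (fun x => -φ x t0) (-gradient (fun x => φ x t0) x0) x0 := by
      rw [hasGradientAt_iff_hasFDerivAt, map_neg]
      exact hp.hasFDerivAt.neg
    have := h2 _ hφ.neg x0 t0 ht0 (by
      refine hmin.neg.congr (Eventually.of_forall fun z => ?_) ?_ <;>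
        simp [sub_eq_add_neg, add_comm]
      exact ⟨ht0.1.le, ht0.2.le⟩) _ _ hp' hq.neg
    rw [norm_neg] at this
    linarith

/-- The limit of the monotone schemes: existence of a viscosity solution with sharp bounds. -/
lemma exists_viscositySolution {N : ℕ} {T L M K : ℝ} {c : Euc N → ℝ → ℝ} {u0 : Euc N → ℝ}
    (hT : 0 < T) (hL : 0 ≤ L) (hM0 : 0 ≤ M) (hK : 0 ≤ K)
    (hcc : Continuous (fun p : Euc N × ℝ => c p.1 p.2))
    (hc : ∀ t x y, |c x t - c y t| ≤ L * ‖x - y‖) (hM : ∀ t x, |c x t| ≤ M)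
    (hu0 : ∀ x y, |u0 x - u0 y| ≤ K * ‖x - y‖) :
    ∃ u : Euc N → ℝ → ℝ, IsViscositySolution N T c u u0 ∧
      (∀ x y, ∀ t ∈ Icc 0 T, |u x t - u y t| ≤ Real.exp (L * T) * K * ‖x - y‖) ∧
      (∀ x, ∀ s ∈ Icc 0 T, ∀ t ∈ Icc 0 T,
        |u x s - u x t| ≤ M * (Real.exp (L * T) * K) * |s - t|) := by
  set G := Real.exp (L * T) * K with hG
  have hG0 : 0 ≤ G := by positivity
  set h : ℕ → ℝ := fun n => 1 / ((n : ℝ) + 1) with hh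
  have hpos : ∀ n, 0 < h n := fun n => Nat.one_div_pos_of_nat
  set w : ℕ → Euc N → ℝ → ℝ := fun n => schemeValue (h n) c u0 with hw
  have hspace : ∀ n x y, ∀ t ∈ Icc 0 T, |w n x t - w n y t| ≤ G * ‖x - y‖ := by
    intro n x y t ht
    refine (schemeValue_lipschitz_space (hpos n) hK hc hu0 ht.1 x y).trans ?_
    rw [hG, mul_comm _ K]
    gcongr
    exact ht.2
  have htime : ∀ n x, ∀ s ∈ Icc 0 T, ∀ t ∈ Icc 0 T, |w n x s - w n x t| ≤ M * G * |s - t| :=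
    fun n x s hs t ht => schemeValue_lipschitz_time (hpos n) hK hL hc hM hu0 x hs ht
  have hzero : (0 : ℝ) ∈ Icc 0 T := ⟨le_rfl, hT.le⟩
  have hw0 : ∀ n x, w n x 0 = u0 x := fun n x => schemeValue_zero (hpos n) c u0 x
  set 𝒰 : Ultrafilter ℕ := hyperfilter ℕ with hU
  have hlim : ∀ x t, ∃ l, t ∈ Icc 0 T → Tendsto (fun n => w n x t) 𝒰 (𝓝 l) := by
    intro x t
    by_cases ht : t ∈ Icc 0 T
    · obtain ⟨l, -, hl⟩ := (isCompact_closedBall (u0 x) (M * G * T)).ultrafilter_le_nhds'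
        (𝒰.map fun n => w n x t) (by
          rw [Ultrafilter.mem_map]
          refine Eventually.of_forall fun n => ?_
          have := htime n x t ht 0 hzero
          rw [hw0, sub_zero, abs_of_nonneg ht.1] at this
          refine mem_closedBall.2 ?_
          rw [Real.dist_eq]
          exact this.trans (by gcongr; exact ht.2))
      exact ⟨l, fun _ => hl⟩
    · exact ⟨0, fun h => absurd h ht⟩
  choose u hu using hlim
  have huspace : ∀ x y, ∀ t ∈ Icc 0 T, |u x t - u y t| ≤ G * ‖x - y‖ := fun x y t ht =>
    le_of_tendsto' ((hu x t ht).sub (hu y t ht)).abs fun n => hspace n x y t ht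
  have hutime : ∀ x, ∀ s ∈ Icc 0 T, ∀ t ∈ Icc 0 T, |u x s - u x t| ≤ M * G * |s - t| :=
    fun x s hs t ht =>
      le_of_tendsto' ((hu x s hs).sub (hu x t ht)).abs fun n => htime n x s hs t ht
  have hlip : ∀ n x y, ∀ s ∈ Icc 0 T, ∀ t ∈ Icc 0 T,
      |w n x s - w n y t| ≤ (G + M * G) * (‖x - y‖ + |s - t|) := by
    intro n x y s hs t ht
    have h1 := hspace n x y s hs
    have h2 := htime n y s hs t ht
    have h3 := abs_sub_le (w n x s) (w n y s) (w n y t)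
    have h4 : 0 ≤ G * |s - t| := by positivity
    have h5 : 0 ≤ M * G * ‖x - y‖ := by positivity
    linarith
  have hh0 : Tendsto h 𝒰 (𝓝 0) :=
    tendsto_one_div_add_atTop_nhds_zero_nat.mono_left Nat.hyperfilter_le_atTop
  have hstep : ∀ n, ∀ t > 0, ∃ s ∈ Ioc 0 (h n), s ≤ t ∧ ∀ x,
      w n x t = ballStep (s * c x (t - s)) (fun y => w n y (t - s)) x :=
    fun n t ht => schemeValue_step (hpos n) c u0 ht
  refine ⟨u, isViscositySolution_iff.2 ⟨fun x => ?_, ?_, ?_⟩, huspace, hutime⟩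
  · refine tendsto_nhds_unique (hu x 0 hzero) ?_
    simp only [hw0]
    exact tendsto_const_nhds
  · exact isViscositySubsolution_of_tendsto hcc hM hM0 (by positivity) hlip hstep hh0 hu
  · refine isViscositySubsolution_of_tendsto (w := fun n x t => -w n x t) (M := M)
      (A := G + M * G) hcc.neg
      (fun t x => by rw [abs_neg]; exact hM t x) hM0 (by positivity)
      (fun n x y s hs t ht => by rw [neg_sub_neg, abs_sub_comm]; exact hlip n x y s hs t ht)
      (fun n t ht => ?_) hh0 (fun x t ht => (hu x t ht).neg)
    obtain ⟨s, hs, hst, hx⟩ := hstep n t ht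
    refine ⟨s, hs, hst, fun x => ?_⟩
    rw [mul_neg, ballStep_neg, hx]

/-- Lipschitz continuous viscosity solutions are unique. -/
lemma IsViscositySolution.eq_of_lipschitz {N : ℕ} {T A M : ℝ} {c u v : Euc N → ℝ → ℝ}
    {u0 : Euc N → ℝ} (hT : 0 < T)
    (hc : ContinuousOn (fun p : Euc N × ℝ => c p.1 p.2) (univ ×ˢ Icc 0 T))
    (hM : ∀ t ∈ Icc 0 T, ∀ x, |c x t| ≤ M) (hM0 : 0 < M) (hA : 0 ≤ A)
    (hu : IsViscositySolution N T c u u0) (hv : IsViscositySolution N T c v u0)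
    (hul : ∀ x y, ∀ s ∈ Icc 0 T, ∀ t ∈ Icc 0 T, |u x s - u y t| ≤ A * (‖x - y‖ + |s - t|))
    (hvl : ∀ x y, ∀ s ∈ Icc 0 T, ∀ t ∈ Icc 0 T, |v x s - v y t| ≤ A * (‖x - y‖ + |s - t|))
    (x : Euc N) {t : ℝ} (ht : t ∈ Icc 0 T) : v x t = u x t := by
  rw [isViscositySolution_iff] at hu hv
  have hneg : ∀ f : Euc N → ℝ → ℝ, (∀ x y, ∀ s ∈ Icc 0 T, ∀ t ∈ Icc 0 T,
      |f x s - f y t| ≤ A * (‖x - y‖ + |s - t|)) → ∀ x y, ∀ s ∈ Icc 0 T, ∀ t ∈ Icc 0 T,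
      |-f x s - -f y t| ≤ A * (‖x - y‖ + |s - t|) := by
    intro f hf x y s hs t ht
    rw [neg_sub_neg, abs_sub_comm]
    exact hf x y s hs t ht
  have hcont : ∀ f : Euc N → ℝ → ℝ, (∀ x y, ∀ s ∈ Icc 0 T, ∀ t ∈ Icc 0 T,
      |f x s - f y t| ≤ A * (‖x - y‖ + |s - t|)) → ContinuousOn (f x) (Icc 0 T) := fun f hf =>
    (lipschitzOnWith_of_abs_sub_le hA hf).continuousOn.comp (f := fun t => (x, t))
      (by fun_prop) (fun t ht => ⟨mem_univ _, ht⟩)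
  have heq : EqOn (v x) (u x) (Ioo 0 T) := by
    intro t ht
    have h1 := hu.2.1.add_nonpos hT hc hM hM0 hA hv.2.2 hul (hneg v hvl)
      (fun y => by rw [hu.1, hv.1]; simp) x ht
    have h2 := hv.2.1.add_nonpos hT hc hM hM0 hA hu.2.2 hvl (hneg u hul)
      (fun y => by rw [hu.1, hv.1]; simp) x ht
    linarith
  exact heq.of_subset_closure (hcont v hvl) (hcont u hul) Ioo_subset_Icc_self
    (by rw [closure_Ioo hT.ne]) ht

/-- existence, uniqueness and gradient bounds for the Lipschitz continuous
viscosity solution of u_t = c(x,t)|Du|, u(·,0) = u0, under (H1). -/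
theorem stmt0 (N : ℕ) (hN : 1 ≤ N) (T : ℝ) (hT : 0 < T)
    (c : Euc N → ℝ → ℝ)
    (hc : ContinuousOn (fun p : Euc N × ℝ => c p.1 p.2) ((Set.univ : Set (Euc N)) ×ˢ Set.Icc (0 : ℝ) T))
    (L1 L1' : ℝ) (hL1 : 0 < L1) (hL1' : 0 < L1')
    (hH1 : ∀ x y : Euc N, ∀ t ∈ Set.Icc (0 : ℝ) T,
      |c x t - c y t| ≤ L1 * ‖x - y‖ ∧ |c x t| ≤ L1')
    (u0 : Euc N → ℝ) (K : ℝ≥0) (hu0 : LipschitzWith K u0) :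
    ∃ u : Euc N → ℝ → ℝ,
      ((∃ K' : ℝ≥0, LipschitzOnWith K' (fun p : Euc N × ℝ => u p.1 p.2)
          ((Set.univ : Set (Euc N)) ×ˢ Set.Icc (0 : ℝ) T)) ∧
        IsViscositySolution N T c u u0) ∧
      (∀ v : Euc N → ℝ → ℝ,
        ((∃ K' : ℝ≥0, LipschitzOnWith K' (fun p : Euc N × ℝ => v p.1 p.2)
            ((Set.univ : Set (Euc N)) ×ˢ Set.Icc (0 : ℝ) T)) ∧
          IsViscositySolution N T c v u0) →
        ∀ x : Euc N, ∀ t ∈ Set.Icc (0 : ℝ) T, v x t = u x t) ∧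
      (∀ᵐ p : Euc N × ℝ ∂volume, p.2 ∈ Set.Ioo 0 T →
        DifferentiableAt ℝ (fun x => u x p.2) p.1 ∧
        DifferentiableAt ℝ (u p.1) p.2 ∧
        ‖gradient (fun x => u x p.2) p.1‖ ≤ Real.exp (L1 * T) * K ∧
        |deriv (u p.1) p.2| ≤ L1' * (Real.exp (L1 * T) * K)) := by
  have hproj : ∀ t ∈ Icc 0 T, (projIcc 0 T hT.le t : ℝ) = t := fun t ht => by
    rw [projIcc_of_mem hT.le ht]
  have hlipsum : ∀ (f : Euc N → ℝ → ℝ) (C A : ℝ≥0), C ≤ A →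
      LipschitzOnWith C (fun p : Euc N × ℝ => f p.1 p.2) (univ ×ˢ Icc 0 T) →
      ∀ x y, ∀ s ∈ Icc 0 T, ∀ t ∈ Icc 0 T, |f x s - f y t| ≤ A * (‖x - y‖ + |s - t|) := by
    intro f C A hCA hf x y s hs t ht
    have h := hf.dist_le_mul (x, s) ⟨mem_univ _, hs⟩ (y, t) ⟨mem_univ _, ht⟩
    rw [Real.dist_eq, Prod.dist_eq, dist_eq_norm, Real.dist_eq] at h
    refine h.trans ?_
    gcongr
    exact max_le_add_of_nonneg (norm_nonneg _) (abs_nonneg _)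
  have hM : ∀ t ∈ Icc 0 T, ∀ x, |c x t| ≤ L1' := fun t ht x => (hH1 x x t ht).2
  have hu0' : ∀ x y, |u0 x - u0 y| ≤ K * ‖x - y‖ := fun x y => by
    simpa [Real.dist_eq, dist_eq_norm] using hu0.dist_le_mul x y
  set c' : Euc N → ℝ → ℝ := fun x t => c x (projIcc 0 T hT.le t) with hc'
  have hcc' : Continuous (fun p : Euc N × ℝ => c' p.1 p.2) :=
    hc.comp_continuous (f := fun p : Euc N × ℝ => (p.1, (projIcc 0 T hT.le p.2 : ℝ)))
      (continuous_fst.prodMk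
        (continuous_subtype_val.comp (continuous_projIcc.comp continuous_snd)))
      (fun p => ⟨mem_univ _, (projIcc 0 T hT.le p.2).2⟩)
  obtain ⟨u, husol', huspace, hutime⟩ := exists_viscositySolution (K := (K : ℝ))
    hT hL1.le hL1'.le K.coe_nonneg hcc'
    (fun t x y => (hH1 x y _ (projIcc 0 T hT.le t).2).1)
    (fun t x => (hH1 x x _ (projIcc 0 T hT.le t).2).2) hu0'
  have hspeed : ∀ x, ∀ t ∈ Ioo 0 T, c' x t = c x t := fun x t ht => by
    simp only [hc', hproj t (Ioo_subset_Icc_self ht)]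
  have husol : IsViscositySolution N T c u u0 := by
    rw [isViscositySolution_iff] at husol' ⊢
    exact ⟨husol'.1, husol'.2.1.congr_speed hspeed,
      husol'.2.2.congr_speed fun x t ht => by rw [hspeed x t ht]⟩
  set G := Real.exp (L1 * T) * K with hG
  have hG0 : 0 ≤ G := by positivity
  have hulip : LipschitzOnWith (Real.toNNReal ((G + L1' * G) * 2))
      (fun p : Euc N × ℝ => u p.1 p.2) (univ ×ˢ Icc 0 T) := by
    refine lipschitzOnWith_of_abs_sub_le (by positivity) fun x y s hs t ht => ?_
    have h1 := huspace x y s hs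
    have h2 := hutime y s hs t ht
    have h3 := abs_sub_le (u x s) (u y s) (u y t)
    have h4 : 0 ≤ G * |s - t| := by positivity
    have h5 : 0 ≤ L1' * G * ‖x - y‖ := by positivity
    linarith
  refine ⟨u, ⟨⟨_, hulip⟩, husol⟩, ?_, ?_⟩
  · rintro v ⟨⟨K', hvlip⟩, hvsol⟩ x t ht
    exact IsViscositySolution.eq_of_lipschitz hT hc hM hL1' (NNReal.coe_nonneg _) husol hvsol
      (hlipsum u _ _ (le_max_left _ K') hulip) (hlipsum v _ _ (le_max_right _ K') hvlip) x ht
  · have : (volume : Measure (Euc N × ℝ)).IsAddHaarMeasure := by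
      rw [Measure.volume_eq_prod]
      infer_instance
    filter_upwards [hulip.ae_differentiableWithinAt_of_mem (μ := volume)] with p hp hpt
    have hdiff : DifferentiableAt ℝ (fun p : Euc N × ℝ => u p.1 p.2) p :=
      (hp ⟨mem_univ _, Ioo_subset_Icc_self hpt⟩).differentiableAt
        (prod_mem_nhds univ_mem (Icc_mem_nhds hpt.1 hpt.2))
    refine ⟨DifferentiableAt.comp (f := fun x => (x, p.2)) p.1 hdiff (by fun_prop),
      DifferentiableAt.comp (f := fun t => (p.1, t)) p.2 hdiff (by fun_prop), ?_, ?_⟩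
    · rw [gradient, LinearIsometryEquiv.norm_map]
      exact norm_fderiv_le_of_lip' ℝ hG0 (Eventually.of_forall fun x =>
        huspace x p.1 p.2 (Ioo_subset_Icc_self hpt))
    · rw [← Real.norm_eq_abs]
      refine norm_deriv_le_of_lip' (C := L1' * G) (by positivity) ?_
      filter_upwards [Icc_mem_nhds hpt.1 hpt.2] with t ht
      exact hutime p.1 t ht p.2 (Ioo_subset_Icc_self hpt)
end
end

section
/- Let N ≥ 1, T > 0, let u0 : ℝ^N → ℝ be Lipschitz continuous with Lipschitz constant Lip(u0), and for i = 1,2 let c_i : ℝ^N × [0,T] → ℝ be continuous satisfying (H1) with constants L1, L1', and let u_i : ℝ^N × [0,T] → ℝ be a continuous viscosity solution of (u_i)_t = c_i(x,t)|Du_i| with initial datum u0. Then for every t ∈ [0,T]: sup_{x ∈ ℝ^N} |u_1(x,t) − u_2(x,t)| ≤ Lip(u0) · e^{L1 t} · ∫_0^t sup_{x ∈ ℝ^N} |c_1(x,s) − c_2(x,s)| ds. -/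
open Set MeasureTheory Filter Metric
open scoped Topology ENNReal NNReal RealInnerProductSpace symmDiff

noncomputable section

/-- The smooth approximation `√(δ² + ‖v‖²)` of the norm. -/
def softNorm {N : ℕ} (δ : ℝ) (v : Euc N) : ℝ := √(δ ^ 2 + ‖v‖ ^ 2)

section softNorm

variable {N : ℕ} {δ : ℝ}

lemma norm_le_softNorm (v : Euc N) : ‖v‖ ≤ softNorm δ v :=
  Real.le_sqrt_of_sq_le (by nlinarith [sq_nonneg δ])

lemma le_softNorm (v : Euc N) : δ ≤ softNorm δ v :=
  Real.le_sqrt_of_sq_le (by nlinarith [sq_nonneg ‖v‖])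

lemma softNorm_pos (hδ : 0 < δ) (v : Euc N) : 0 < softNorm δ v :=
  hδ.trans_le (le_softNorm v)

lemma softNorm_zero (hδ : 0 < δ) : softNorm δ (0 : Euc N) = δ := by
  simp [softNorm, Real.sqrt_sq hδ.le]

lemma contDiff_softNorm (hδ : 0 < δ) : ContDiff ℝ 1 (softNorm δ : Euc N → ℝ) :=
  (contDiff_const.add (contDiff_norm_sq ℝ)).sqrt fun v => by positivity

lemma hasFDerivAt_softNorm (hδ : 0 < δ) (v : Euc N) :
    HasFDerivAt (softNorm δ) (InnerProductSpace.toDual ℝ (Euc N) ((softNorm δ v)⁻¹ • v)) v := by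
  have h := (((hasFDerivAt_id v).norm_sq).const_add (δ ^ 2)).sqrt
    (by have := hδ; simp only [id]; positivity)
  have hp := (softNorm_pos hδ v).ne'
  refine h.congr_fderiv ?_
  ext w
  simp only [softNorm, id] at hp ⊢
  simp
  field_simp

lemma hasFDerivAt_softNorm_sub_const (hδ : 0 < δ) (x y : Euc N) :
    HasFDerivAt (fun x => softNorm δ (x - y))
      (InnerProductSpace.toDual ℝ (Euc N) ((softNorm δ (x - y))⁻¹ • (x - y))) x :=
  (HasFDerivAt.comp (g := softNorm δ) x (hasFDerivAt_softNorm hδ (x - y))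
    ((hasFDerivAt_id x).sub_const y)).congr_fderiv (by ext v; simp)

lemma hasFDerivAt_softNorm_const_sub (hδ : 0 < δ) (x y : Euc N) :
    HasFDerivAt (fun y => softNorm δ (x - y))
      (-(InnerProductSpace.toDual ℝ (Euc N) ((softNorm δ (x - y))⁻¹ • (x - y)))) y :=
  (HasFDerivAt.comp (g := softNorm δ) y (hasFDerivAt_softNorm hδ (x - y))
    ((hasFDerivAt_id y).const_sub x)).congr_fderiv (by ext v; simp)

lemma norm_inv_softNorm_smul_le (hδ : 0 < δ) (v : Euc N) : ‖(softNorm δ v)⁻¹ • v‖ ≤ 1 := by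
  have hp := softNorm_pos hδ v
  rw [norm_smul, Real.norm_of_nonneg (inv_nonneg.2 hp.le), inv_mul_le_iff₀ hp, mul_one]
  exact norm_le_softNorm v

end softNorm

/-- A barrier equal to `M` outside a backward cone of slope `A` with vertex near `(z, t₀)`,
and vanishing at the vertex. -/
def coneBarrier {N : ℕ} (M A : ℝ) (z : Euc N) (t₀ : ℝ) (x : Euc N) (t : ℝ) : ℝ :=
  M * Real.smoothTransition (softNorm 1 (x - z) + A * (t - t₀) - 1)

section coneBarrier

variable {N : ℕ} {M A : ℝ} (z : Euc N) (t₀ : ℝ)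

lemma contDiff_coneBarrier :
    ContDiff ℝ 1 (fun p : Euc N × ℝ => coneBarrier M A z t₀ p.1 p.2) := by
  have h : ContDiff ℝ 1 (fun p : Euc N × ℝ => softNorm 1 (p.1 - z) + A * (p.2 - t₀) - 1) :=
    (((contDiff_softNorm one_pos).comp (contDiff_fst.sub contDiff_const)).add
      (contDiff_const.mul (contDiff_snd.sub contDiff_const))).sub contDiff_const
  exact contDiff_const.mul ((Real.smoothTransition.contDiff (n := 1)).comp h)

lemma coneBarrier_nonneg (hM : 0 ≤ M) (x : Euc N) (t : ℝ) : 0 ≤ coneBarrier M A z t₀ x t :=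
  mul_nonneg hM (Real.smoothTransition.nonneg _)

lemma coneBarrier_vertex : coneBarrier M A z t₀ z t₀ = 0 := by
  simp [coneBarrier, softNorm_zero, Real.smoothTransition.zero_of_nonpos]

lemma lt_of_coneBarrier_lt {x : Euc N} {t : ℝ} (h : coneBarrier M A z t₀ x t < M) :
    softNorm 1 (x - z) + A * (t - t₀) < 2 := by
  by_contra! h'
  rw [coneBarrier, Real.smoothTransition.one_of_one_le (by linarith), mul_one] at h
  exact h.false

lemma exists_deriv_coneBarrier (hM : 0 ≤ M) (hA : 0 ≤ A) (x : Euc N) (t : ℝ) :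
    ∃ (e : ℝ) (q : Euc N), HasDerivAt (coneBarrier M A z t₀ x) e t ∧
      HasGradientAt (fun x => coneBarrier M A z t₀ x t) q x ∧ A * ‖q‖ ≤ e := by
  set r := softNorm 1 (x - z) + A * (t - t₀) - 1 with hr
  set d := deriv Real.smoothTransition r with hd
  have hd0 : 0 ≤ d := Real.smoothTransition.monotone.deriv_nonneg
  have hσ : HasDerivAt Real.smoothTransition d r :=
    ((Real.smoothTransition.contDiff (n := 1)).differentiable one_ne_zero r).hasDerivAt
  refine ⟨M * (d * A), M • d • ((softNorm 1 (x - z))⁻¹ • (x - z)), ?_, ?_, ?_⟩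
  · have h : HasDerivAt (fun t => softNorm 1 (x - z) + A * (t - t₀) - 1) A t := by
      simpa using ((((hasDerivAt_id t).sub_const t₀).const_mul A).const_add
        (softNorm 1 (x - z))).sub_const 1
    exact (hσ.comp t h).const_mul M
  · have h : HasFDerivAt (fun x => softNorm 1 (x - z) + A * (t - t₀) - 1)
        (InnerProductSpace.toDual ℝ (Euc N) ((softNorm 1 (x - z))⁻¹ • (x - z))) x :=
      ((hasFDerivAt_softNorm_sub_const one_pos x z).add_const (A * (t - t₀))).sub_const 1
    rw [hasGradientAt_iff_hasFDerivAt]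
    have h' := (hσ.comp_hasFDerivAt x h).const_mul M
    rw [map_smul, map_smul]
    exact h'
  · rw [norm_smul, norm_smul, Real.norm_of_nonneg hM, Real.norm_of_nonneg hd0]
    have := norm_inv_softNorm_smul_le one_pos (x - z)
    calc A * (M * (d * _)) = (M * (d * A)) * ‖(softNorm 1 (x - z))⁻¹ • (x - z)‖ := by ring
      _ ≤ (M * (d * A)) * 1 := by gcongr
      _ = _ := mul_one _

end coneBarrier

lemma HasGradientAt.add_fun {N : ℕ} {f g : Euc N → ℝ} {p q x : Euc N}
    (hf : HasGradientAt f p x) (hg : HasGradientAt g q x) :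
    HasGradientAt (fun x => f x + g x) (p + q) x := by
  rw [hasGradientAt_iff_hasFDerivAt, map_add]
  exact hf.hasFDerivAt.add hg.hasFDerivAt

lemma HasGradientAt.sub_fun {N : ℕ} {f g : Euc N → ℝ} {p q x : Euc N}
    (hf : HasGradientAt f p x) (hg : HasGradientAt g q x) :
    HasGradientAt (fun x => f x - g x) (p - q) x := by
  rw [hasGradientAt_iff_hasFDerivAt, map_sub]
  exact hf.hasFDerivAt.sub hg.hasFDerivAt

namespace IsViscositySolution

variable {N : ℕ} {T : ℝ} {c u : Euc N → ℝ → ℝ} {u0 : Euc N → ℝ}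

/-- The subsolution inequality is insensitive to a barrier of slope at least `|c|`. -/
lemma deriv_le_of_coneBarrier (hu : IsViscositySolution N T c u u0) {M A t₀ : ℝ} {z : Euc N}
    (hM : 0 ≤ M) {ψ : Euc N → ℝ → ℝ} (hψ : ContDiff ℝ 1 (fun p : Euc N × ℝ => ψ p.1 p.2))
    {x : Euc N} {t : ℝ} (ht : t ∈ Ioo 0 T) (hcA : |c x t| ≤ A) {a : ℝ} {p : Euc N}
    (ha : HasDerivAt (ψ x) a t) (hp : HasGradientAt (fun x => ψ x t) p x)
    (hmax : IsLocalMaxOn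
      (fun p : Euc N × ℝ => u p.1 p.2 - (ψ p.1 p.2 + coneBarrier M A z t₀ p.1 p.2))
      (univ ×ˢ Icc 0 T) (x, t)) :
    a ≤ c x t * ‖p‖ := by
  have hA : 0 ≤ A := (abs_nonneg _).trans hcA
  obtain ⟨e, q, he, hq, hqe⟩ := exists_deriv_coneBarrier z t₀ hM hA x t
  have h := (hu.2 (fun x t => ψ x t + coneBarrier M A z t₀ x t)
    (hψ.add (contDiff_coneBarrier z t₀)) x t ht).1 hmax
  rw [(hp.add_fun hq).gradient, (ha.fun_add he).deriv] at h
  have h1 : |‖p + q‖ - ‖p‖| ≤ ‖q‖ := by simpa using abs_norm_sub_norm_le (p + q) p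
  have h2 : c x t * (‖p + q‖ - ‖p‖) ≤ A * ‖q‖ :=
    (le_abs_self _).trans (by rw [abs_mul]; gcongr)
  linarith

/-- The supersolution inequality is insensitive to a barrier of slope at least `|c|`. -/
lemma le_deriv_of_coneBarrier (hu : IsViscositySolution N T c u u0) {M A t₀ : ℝ} {z : Euc N}
    (hM : 0 ≤ M) {ψ : Euc N → ℝ → ℝ} (hψ : ContDiff ℝ 1 (fun p : Euc N × ℝ => ψ p.1 p.2))
    {x : Euc N} {t : ℝ} (ht : t ∈ Ioo 0 T) (hcA : |c x t| ≤ A) {a : ℝ} {p : Euc N}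
    (ha : HasDerivAt (ψ x) a t) (hp : HasGradientAt (fun x => ψ x t) p x)
    (hmin : IsLocalMinOn
      (fun p : Euc N × ℝ => u p.1 p.2 - (ψ p.1 p.2 - coneBarrier M A z t₀ p.1 p.2))
      (univ ×ˢ Icc 0 T) (x, t)) :
    c x t * ‖p‖ ≤ a := by
  have hA : 0 ≤ A := (abs_nonneg _).trans hcA
  obtain ⟨e, q, he, hq, hqe⟩ := exists_deriv_coneBarrier z t₀ hM hA x t
  have h := (hu.2 (fun x t => ψ x t - coneBarrier M A z t₀ x t)
    (hψ.sub (contDiff_coneBarrier z t₀)) x t ht).2 hmin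
  rw [(hp.sub_fun hq).gradient, (ha.fun_sub he).deriv] at h
  have h1 : |‖p‖ - ‖p - q‖| ≤ ‖q‖ := by simpa using abs_norm_sub_norm_le p (p - q)
  have h2 : c x t * (‖p‖ - ‖p - q‖) ≤ A * ‖q‖ :=
    (le_abs_self _).trans (by rw [abs_mul]; gcongr)
  linarith

end IsViscositySolution

lemma exists_time_modulus {N : ℕ} {T : ℝ} {f : Euc N → ℝ → ℝ}
    (hf : ContinuousOn (fun p : Euc N × ℝ => f p.1 p.2) (univ ×ˢ Icc 0 T))
    (z : Euc N) (R : ℝ) {ω : ℝ} (hω : 0 < ω) :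
    ∃ d > 0, ∀ x ∈ closedBall z R, ∀ t ∈ Icc 0 T, ∀ s ∈ Icc 0 T,
      |t - s| < d → |f x t - f x s| < ω := by
  have hQ : IsCompact (closedBall z R ×ˢ Icc 0 T) := (isCompact_closedBall z R).prod isCompact_Icc
  have hu := hQ.uniformContinuousOn_of_continuous
    (hf.mono (prod_mono (subset_univ _) Subset.rfl))
  obtain ⟨d, hd, h⟩ := Metric.uniformContinuousOn_iff.1 hu ω hω
  refine ⟨d, hd, fun x hx t ht s hs hts => ?_⟩
  have := h (x, t) ⟨hx, ht⟩ (x, s) ⟨hx, hs⟩ (by simpa [Prod.dist_eq, Real.dist_eq, hd] using hts)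
  simpa [Real.dist_eq] using this

lemma exists_bound_on_cylinder {N : ℕ} {T : ℝ} {f : Euc N → ℝ → ℝ}
    (hf : ContinuousOn (fun p : Euc N × ℝ => f p.1 p.2) (univ ×ˢ Icc 0 T))
    (z : Euc N) (R : ℝ) :
    ∃ B, ∀ x ∈ closedBall z R, ∀ t ∈ Icc 0 T, |f x t| ≤ B := by
  have hQ : IsCompact (closedBall z R ×ˢ Icc 0 T) := (isCompact_closedBall z R).prod isCompact_Icc
  obtain ⟨B, hB⟩ := hQ.exists_bound_of_continuousOn
    (hf.mono (prod_mono (subset_univ _) Subset.rfl))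
  exact ⟨B, fun x hx t ht => hB (x, t) ⟨hx, ht⟩⟩

lemma mem_cylinder_nhdsWithin {N : ℕ} {z : Euc N} {R T : ℝ} {x : Euc N} (hx : x ∈ ball z R)
    (t : ℝ) : closedBall z R ×ˢ Icc 0 T ∈ 𝓝[univ ×ˢ Icc 0 T] (x, t) := by
  filter_upwards [self_mem_nhdsWithin, mem_nhdsWithin_of_mem_nhds
    ((isOpen_ball.preimage continuous_fst).mem_nhds (x := (x, t)) hx)] with p hp hp'
  exact ⟨ball_subset_closedBall hp', hp.2⟩

set_option maxHeartbeats 800000 in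
/-- Quantitative comparison on a cone of dependence, with a smoothing parameter `η`. -/
lemma sub_le_of_le_on_cylinder {N : ℕ} {T : ℝ} {u0 : Euc N → ℝ} {K : ℝ≥0}
    (hu0 : LipschitzWith K u0) {c1 c2 u1 u2 : Euc N → ℝ → ℝ} {L A : ℝ} (hL : 0 ≤ L) (hA : 0 ≤ A)
    (hc2 : ContinuousOn (fun p : Euc N × ℝ => c2 p.1 p.2) (univ ×ˢ Icc 0 T))
    (hc1A : ∀ x, ∀ t ∈ Icc 0 T, |c1 x t| ≤ A) (hc2A : ∀ x, ∀ t ∈ Icc 0 T, |c2 x t| ≤ A)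
    (hc2L : ∀ x y, ∀ t ∈ Icc 0 T, |c2 x t - c2 y t| ≤ L * ‖x - y‖)
    (hu1c : ContinuousOn (fun p : Euc N × ℝ => u1 p.1 p.2) (univ ×ˢ Icc 0 T))
    (hu2c : ContinuousOn (fun p : Euc N × ℝ => u2 p.1 p.2) (univ ×ˢ Icc 0 T))
    (hu1 : IsViscositySolution N T c1 u1 u0) (hu2 : IsViscositySolution N T c2 u2 u0)
    {t₀ : ℝ} (ht₀ : t₀ ∈ Ico 0 T) (hAT : 1 ≤ A * (T - t₀)) (z : Euc N)
    {g : ℝ → ℝ} (hg : Continuous g) (hg0 : ∀ t, 0 ≤ g t)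
    (hgc : ∀ x ∈ closedBall z (2 + A * t₀), ∀ t ∈ Icc 0 T, c1 x t - c2 x t ≤ g t)
    {η : ℝ} (hη : 0 < η) :
    u1 z t₀ - u2 z t₀ ≤ K * Real.exp (L * t₀) * (η + ∫ τ in (0 : ℝ)..t₀, g τ) + η * t₀ := by
  by_contra! hcon
  set R := 2 + A * t₀ with hR
  set G : ℝ → ℝ := fun t => ∫ τ in (0 : ℝ)..t, g τ with hG
  have hGd : ∀ t, HasDerivAt G (g t) t := fun t => (hg.integral_hasStrictDerivAt 0 t).hasDerivAt
  have hG1 : ContDiff ℝ 1 G := by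
    refine contDiff_one_iff_deriv.2 ⟨fun t => (hGd t).differentiableAt, ?_⟩
    rwa [funext fun t => (hGd t).deriv]
  have hG0 : ∀ t, 0 ≤ t → 0 ≤ G t := fun t ht =>
    intervalIntegral.integral_nonneg ht fun τ _ => hg0 τ
  have hK : (0 : ℝ) ≤ K := K.2
  have hRpos : 0 < R := by have := mul_nonneg hA ht₀.1; linarith
  set θ := u1 z t₀ - u2 z t₀ - (K * Real.exp (L * t₀) * (η + G t₀) + η * t₀) with hθ
  have hθ0 : 0 < θ := sub_pos.2 hcon
  -- moduli of continuity in time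
  obtain ⟨B1, hB1⟩ := exists_bound_on_cylinder hu1c z R
  obtain ⟨B2, hB2⟩ := exists_bound_on_cylinder hu2c z R
  obtain ⟨d1, hd1, hm1⟩ := exists_time_modulus hu1c z R hθ0
  obtain ⟨d2, hd2, hm2⟩ := exists_time_modulus hu2c z R hθ0
  set ω := η / (K * Real.exp (L * T) + 1) with hω
  have hω0 : 0 < ω := by positivity
  obtain ⟨d3, hd3, hm3⟩ := exists_time_modulus hc2 z R hω0
  set B := max (B1 + B2) 0 with hB
  have hB0 : 0 ≤ B := le_max_right _ _
  set d := min d1 (min d2 d3) with hd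
  have hd0 : 0 < d := lt_min hd1 (lt_min hd2 hd3)
  set κ := (B + 1) / d ^ 2 with hκ
  have hκ0 : 0 < κ := by positivity
  set M := B + 1 with hM
  have hM0 : 0 ≤ M := by positivity
  -- maximize the doubled functional
  set Q := closedBall z R ×ˢ Icc 0 T with hQ
  have hQc : IsCompact Q := (isCompact_closedBall z R).prod isCompact_Icc
  have hQsub : Q ⊆ univ ×ˢ Icc 0 T := prod_mono (subset_univ _) Subset.rfl
  set Φ : Euc N → ℝ → ℝ := coneBarrier M A z t₀ with hΦ
  have hΦ1 : ContDiff ℝ 1 (fun p : Euc N × ℝ => Φ p.1 p.2) := contDiff_coneBarrier z t₀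
  set w : Euc N → Euc N → ℝ → ℝ := fun x y t =>
    K * Real.exp (L * t) * (softNorm η (x - y) + G t) + η * t with hw
  set Ψ : (Euc N × ℝ) × (Euc N × ℝ) → ℝ := fun P =>
    u1 P.1.1 P.1.2 - u2 P.2.1 P.2.2 - w P.1.1 P.2.1 P.1.2 - κ * (P.1.2 - P.2.2) ^ 2
      - Φ P.1.1 P.1.2 - Φ P.2.1 P.2.2 with hΨ
  have hΨc : ContinuousOn Ψ (Q ×ˢ Q) := by
    have h1 : ContinuousOn (fun P : (Euc N × ℝ) × (Euc N × ℝ) => u1 P.1.1 P.1.2) (Q ×ˢ Q) :=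
      (hu1c.mono hQsub).comp continuousOn_fst fun P hP => hP.1
    have h2 : ContinuousOn (fun P : (Euc N × ℝ) × (Euc N × ℝ) => u2 P.2.1 P.2.2) (Q ×ˢ Q) :=
      (hu2c.mono hQsub).comp continuousOn_snd fun P hP => hP.2
    have h3 : Continuous (fun P : (Euc N × ℝ) × (Euc N × ℝ) => w P.1.1 P.2.1 P.1.2) := by
      have := (contDiff_softNorm (N := N) hη).continuous
      have := hG1.continuous
      simp only [hw]
      fun_prop
    have h4 : Continuous (fun P : (Euc N × ℝ) × (Euc N × ℝ) => Φ P.1.1 P.1.2) :=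
      hΦ1.continuous.comp continuous_fst
    have h5 : Continuous (fun P : (Euc N × ℝ) × (Euc N × ℝ) => Φ P.2.1 P.2.2) :=
      hΦ1.continuous.comp continuous_snd
    have h6 : Continuous (fun P : (Euc N × ℝ) × (Euc N × ℝ) => κ * (P.1.2 - P.2.2) ^ 2) := by
      fun_prop
    exact ((((h1.sub h2).sub h3.continuousOn).sub h6.continuousOn).sub h4.continuousOn).sub
      h5.continuousOn
  have hzQ : (z, t₀) ∈ Q := ⟨mem_closedBall_self hRpos.le, ht₀.1, ht₀.2.le⟩
  obtain ⟨⟨⟨x, t⟩, ⟨y, s⟩⟩, ⟨hxQ, hyQ⟩, hmax⟩ :=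
    (hQc.prod hQc).exists_isMaxOn ⟨((z, t₀), (z, t₀)), hzQ, hzQ⟩ hΨc
  replace hmax : ∀ p ∈ Q, ∀ q ∈ Q, Ψ (p, q) ≤ Ψ ((x, t), (y, s)) :=
    fun p hp q hq => hmax (show (p, q) ∈ Q ×ˢ Q from ⟨hp, hq⟩)
  have hxQ' : x ∈ closedBall z R := hxQ.1
  have hyQ' : y ∈ closedBall z R := hyQ.1
  have ht : t ∈ Icc 0 T := hxQ.2
  have hs : s ∈ Icc 0 T := hyQ.2
  have hθΨ : θ ≤ Ψ ((x, t), (y, s)) := by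
    refine le_of_eq_of_le ?_ (hmax _ hzQ _ hzQ)
    simp [hΨ, hw, hΦ, coneBarrier_vertex, softNorm_zero hη, hθ]
  simp only [hΨ] at hθΨ
  have hΦx : 0 ≤ Φ x t := coneBarrier_nonneg z t₀ hM0 x t
  have hΦy : 0 ≤ Φ y s := coneBarrier_nonneg z t₀ hM0 y s
  have hexp1 : 1 ≤ Real.exp (L * t) := Real.one_le_exp (mul_nonneg hL ht.1)
  have hρ := norm_le_softNorm (δ := η) (x - y)
  have hρ0 := softNorm_pos hη (x - y)
  set ρ := softNorm η (x - y) with hρdef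
  have hGt := hG0 t ht.1
  have hηt : 0 ≤ η * t := mul_nonneg hη.le ht.1
  have hwK : K * ‖x - y‖ ≤ w x y t := by
    have h1 : K * ‖x - y‖ ≤ K * Real.exp (L * t) * (ρ + G t) := by
      rw [mul_assoc]
      refine mul_le_mul_of_nonneg_left ?_ hK
      nlinarith [norm_nonneg (x - y)]
    simp only [hw]; linarith
  have hw0 : 0 ≤ w x y t := (by positivity : (0 : ℝ) ≤ K * ‖x - y‖).trans hwK
  have hκts : 0 ≤ κ * (t - s) ^ 2 := by positivity
  have huB : u1 x t - u2 y s ≤ B := by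
    have h1 := (abs_le.1 (hB1 x hxQ' t ht)).2
    have h2 := (abs_le.1 (hB2 y hyQ' s hs)).1
    have h3 := le_max_left (B1 + B2) 0
    linarith
  -- the maximum point is interior
  have interior : ∀ x' t', Φ x' t' < M → t' ∈ Icc 0 T → x' ∈ ball z R ∧ t' < T := by
    intro x' t' h ht'
    have h1 := lt_of_coneBarrier_lt z t₀ h
    have h2 := norm_le_softNorm (δ := 1) (x' - z)
    have h3 := le_softNorm (δ := 1) (x' - z)
    refine ⟨?_, ?_⟩
    · rw [mem_ball_iff_norm]
      nlinarith [mul_nonneg hA ht'.1]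
    · by_contra! h4
      have := mul_le_mul_of_nonneg_left (sub_le_sub_right h4 t₀) hA
      linarith
  obtain ⟨hxb, htT⟩ := interior x t (by linarith) ht
  obtain ⟨hyb, hsT⟩ := interior y s (by linarith) hs
  have hts : |t - s| < d := by
    refine abs_lt_of_sq_lt_sq ?_ hd0.le
    have : κ * (t - s) ^ 2 < κ * d ^ 2 := by
      have : κ * d ^ 2 = B + 1 := div_mul_cancel₀ _ (by positivity)
      linarith
    exact lt_of_mul_lt_mul_left this hκ0.le
  have hd1' : |t - s| < d1 := hts.trans_le (min_le_left _ _)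
  have hd2' : |t - s| < d2 := hts.trans_le ((min_le_right _ _).trans (min_le_left _ _))
  have hd3' : |t - s| < d3 := hts.trans_le ((min_le_right _ _).trans (min_le_right _ _))
  have hu0xy : u0 x - u0 y ≤ K * ‖x - y‖ := by
    have := hu0.dist_le_mul x y
    rw [Real.dist_eq, dist_eq_norm] at this
    exact (le_abs_self _).trans this
  have ht0 : 0 < t := by
    refine ht.1.lt_of_ne' fun h => ?_
    have h1 := (abs_lt.1 (hm2 y hyQ' t ht s hs hd2')).2
    rw [h, hu2.1] at h1
    have h2 := hu1.1 x
    rw [h] at hθΨ hwK hκts hΦx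
    linarith
  have hs0 : 0 < s := by
    refine hs.1.lt_of_ne' fun h => ?_
    have h1 := (abs_lt.1 (hm1 x hxQ' t ht s hs hd1')).2
    rw [h, hu1.1] at h1
    have h2 := hu2.1 y
    rw [h] at hθΨ hκts hΦy
    linarith
  -- viscosity inequalities at the maximum point
  set a := K * Real.exp (L * t) with ha
  have ha0 : 0 ≤ a := by positivity
  set p : Euc N := a • (ρ⁻¹ • (x - y)) with hp
  have hsub := hu1.deriv_le_of_coneBarrier hM0 (M := M) (A := A) (t₀ := t₀) (z := z)
    (ψ := fun x' t' => w x' y t' + κ * (t' - s) ^ 2)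
    (a := K * (Real.exp (L * t) * L) * (ρ + G t) + a * g t + η + κ * (2 * (t - s))) (p := p)
    (by
      have h1 := contDiff_softNorm (N := N) hη
      simp only [hw]
      fun_prop)
    (x := x) (t := t) ⟨ht0, htT⟩ (hc1A x t ht)
    (by
      have h1 : HasDerivAt (fun t' => (K : ℝ) * Real.exp (L * t'))
          (K * (Real.exp (L * t) * L)) t := by
        simpa using (((hasDerivAt_id t).const_mul L).exp).const_mul (K : ℝ)
      have h2 : HasDerivAt (fun t' => ρ + G t') (g t) t := (hGd t).const_add ρ
      have h3 : HasDerivAt (fun t' => η * t') η t := by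
        simpa using (hasDerivAt_id t).const_mul η
      have h4 : HasDerivAt (fun t' => κ * (t' - s) ^ 2) (κ * (2 * (t - s))) t := by
        simpa using (((hasDerivAt_id t).sub_const s).fun_pow 2).const_mul κ
      exact ((h1.mul h2).add h3).add h4)
    (by
      have h1 := hasFDerivAt_softNorm_sub_const hη x y
      rw [hasGradientAt_iff_hasFDerivAt]
      exact ((((h1.add_const (G t)).const_mul a).add_const (η * t)).add_const
        (κ * (t - s) ^ 2)).congr_fderiv (by simp only [hp, map_smul, hρdef]))
    (by
      filter_upwards [mem_cylinder_nhdsWithin hxb t] with q hq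
      have := hmax q hq (y, s) hyQ
      simp only [hΨ] at this
      linarith)
  have hsuper := hu2.le_deriv_of_coneBarrier hM0 (M := M) (A := A) (t₀ := t₀) (z := z)
    (ψ := fun y' s' => -(a * softNorm η (x - y')) - κ * (t - s') ^ 2)
    (a := κ * (2 * (t - s))) (p := p)
    (by
      have h1 := contDiff_softNorm (N := N) hη
      fun_prop)
    (x := y) (t := s) ⟨hs0, hsT⟩ (hc2A y s hs)
    (by
      have h4 : HasDerivAt (fun s' => κ * (t - s') ^ 2) (-(κ * (2 * (t - s)))) s := by
        simpa using (((hasDerivAt_id s).const_sub t).fun_pow 2).const_mul κ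
      simpa using h4.const_sub (-(a * softNorm η (x - y))))
    (by
      have h1 := hasFDerivAt_softNorm_const_sub hη x y
      rw [hasGradientAt_iff_hasFDerivAt]
      exact (((h1.const_mul a).neg).sub_const (κ * (t - s) ^ 2)).congr_fderiv
        (by simp only [hp, map_smul, hρdef, smul_neg, neg_neg]))
    (by
      filter_upwards [mem_cylinder_nhdsWithin hyb s] with q hq
      have := hmax (x, t) hxQ q hq
      simp only [hΨ, hw] at this
      linarith)
  -- the two inequalities are incompatible
  have hpa : ‖p‖ ≤ a := by
    rw [hp, norm_smul, Real.norm_of_nonneg ha0]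
    exact mul_le_of_le_one_right ha0 (norm_inv_softNorm_smul_le hη (x - y))
  have hcdiff : c1 x t - c2 y s ≤ g t + L * ρ + ω := by
    have h1 := hgc x hxQ' t ht
    have h2 := (abs_le.1 (hc2L x y t ht)).2
    have h3 := (abs_lt.1 (hm3 y hyQ' t ht s hs hd3')).2
    have h4 := mul_le_mul_of_nonneg_left hρ hL
    linarith
  have hωa : ω * a < η := by
    have h1 : a ≤ K * Real.exp (L * T) :=
      mul_le_mul_of_nonneg_left (Real.exp_le_exp.2 (mul_le_mul_of_nonneg_left ht.2 hL)) hK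
    have h2 : ω * (K * Real.exp (L * T) + 1) = η := div_mul_cancel₀ _ (by positivity)
    have h3 := mul_le_mul_of_nonneg_left h1 hω0.le
    linarith
  have hgt := hg0 t
  have hkey : (c1 x t - c2 y s) * ‖p‖ ≤ (g t + L * ρ + ω) * a :=
    (mul_le_mul_of_nonneg_right hcdiff (norm_nonneg p)).trans
      (mul_le_mul_of_nonneg_left hpa (by positivity))
  have hLG : 0 ≤ a * L * G t := by positivity
  have haL : K * (Real.exp (L * t) * L) * (ρ + G t) = a * L * ρ + a * L * G t := by
    rw [ha]; ring
  linarith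

section velocityGap

variable {N : ℕ} {T : ℝ} {c1 c2 : Euc N → ℝ → ℝ} {C : ℝ}

lemma bddAbove_velocityGap
    (hC : ∀ x, ∀ t ∈ Icc 0 T, |c1 x t - c2 x t| ≤ C) {t : ℝ} (ht : t ∈ Icc 0 T) :
    BddAbove (range fun x => |c1 x t - c2 x t|) :=
  ⟨C, by rintro _ ⟨x, rfl⟩; exact hC x t ht⟩

lemma continuous_velocityGap_projIcc (hT : 0 ≤ T)
    (hc1 : ContinuousOn (fun p : Euc N × ℝ => c1 p.1 p.2) (univ ×ˢ Icc 0 T))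
    (hc2 : ContinuousOn (fun p : Euc N × ℝ => c2 p.1 p.2) (univ ×ˢ Icc 0 T)) :
    Continuous fun q : ℝ × Euc N =>
      |c1 q.2 (projIcc 0 T hT q.1) - c2 q.2 (projIcc 0 T hT q.1)| := by
  have hπ : Continuous fun q : ℝ × Euc N => (q.2, (projIcc 0 T hT q.1 : ℝ)) := by fun_prop
  exact ((hc1.sub hc2).comp_continuous hπ fun q => ⟨mem_univ _, (projIcc 0 T hT q.1).2⟩).abs

lemma integrableOn_iSup_velocityGap (hT : 0 ≤ T)
    (hc1 : ContinuousOn (fun p : Euc N × ℝ => c1 p.1 p.2) (univ ×ˢ Icc 0 T))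
    (hc2 : ContinuousOn (fun p : Euc N × ℝ => c2 p.1 p.2) (univ ×ˢ Icc 0 T))
    (hC : ∀ x, ∀ t ∈ Icc 0 T, |c1 x t - c2 x t| ≤ C) :
    IntegrableOn (fun t => ⨆ x, |c1 x t - c2 x t|) (Icc 0 T) := by
  have hlsc : LowerSemicontinuous fun t =>
      ⨆ x, |c1 x (projIcc 0 T hT t) - c2 x (projIcc 0 T hT t)| :=
    lowerSemicontinuous_ciSup (fun t => bddAbove_velocityGap hC (projIcc 0 T hT t).2) fun x =>
      ((continuous_velocityGap_projIcc hT hc1 hc2).comp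
        (Continuous.prodMk_left x)).lowerSemicontinuous
  have hint := Measure.integrableOn_of_bounded (s := Icc 0 T) (M := C) (μ := volume)
    measure_Icc_lt_top.ne hlsc.measurable.aestronglyMeasurable
    (Eventually.of_forall fun t => by
      rw [Real.norm_of_nonneg (Real.iSup_nonneg fun x => abs_nonneg _)]
      exact ciSup_le fun x => hC x _ (projIcc 0 T hT t).2)
  refine hint.congr_fun (fun t ht => ?_) measurableSet_Icc
  simp only [projIcc_of_mem hT ht]

end velocityGap

lemma sub_le_integral_iSup_of_lt {N : ℕ} {T : ℝ} {u0 : Euc N → ℝ} {K : ℝ≥0}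
    (hu0 : LipschitzWith K u0) {c1 c2 u1 u2 : Euc N → ℝ → ℝ} {L L' : ℝ} (hL : 0 ≤ L)
    (hL' : 0 ≤ L')
    (hc1 : ContinuousOn (fun p : Euc N × ℝ => c1 p.1 p.2) (univ ×ˢ Icc 0 T))
    (hc2 : ContinuousOn (fun p : Euc N × ℝ => c2 p.1 p.2) (univ ×ˢ Icc 0 T))
    (hc1b : ∀ x, ∀ t ∈ Icc 0 T, |c1 x t| ≤ L') (hc2b : ∀ x, ∀ t ∈ Icc 0 T, |c2 x t| ≤ L')
    (hc2L : ∀ x y, ∀ t ∈ Icc 0 T, |c2 x t - c2 y t| ≤ L * ‖x - y‖)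
    (hu1c : ContinuousOn (fun p : Euc N × ℝ => u1 p.1 p.2) (univ ×ˢ Icc 0 T))
    (hu2c : ContinuousOn (fun p : Euc N × ℝ => u2 p.1 p.2) (univ ×ˢ Icc 0 T))
    (hu1 : IsViscositySolution N T c1 u1 u0) (hu2 : IsViscositySolution N T c2 u2 u0)
    {t : ℝ} (ht : t ∈ Ico 0 T) (z : Euc N) :
    u1 z t - u2 z t ≤
      K * Real.exp (L * t) * ∫ s in (0 : ℝ)..t, ⨆ y, |c1 y s - c2 y s| := by
  have hT : 0 ≤ T := ht.1.trans ht.2.le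
  have hC : ∀ x, ∀ t ∈ Icc 0 T, |c1 x t - c2 x t| ≤ L' + L' := fun x t ht =>
    (abs_sub _ _).trans (add_le_add (hc1b x t ht) (hc2b x t ht))
  have htT : 0 < T - t := sub_pos.2 ht.2
  set A := L' + 1 / (T - t) with hA
  have hL'A : L' ≤ A := le_add_of_nonneg_right (by positivity)
  have hAT : 1 ≤ A * (T - t) := by
    rw [hA, add_mul, one_div_mul_cancel htT.ne']
    exact le_add_of_nonneg_left (by positivity)
  set R := 2 + A * t
  set g : ℝ → ℝ := fun s => sSup ((fun x =>
    |c1 x (projIcc 0 T hT s) - c2 x (projIcc 0 T hT s)|) '' closedBall z R) with hg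
  have hgcont : Continuous g := (isCompact_closedBall z R).continuous_sSup
    (continuous_velocityGap_projIcc hT hc1 hc2)
  have hg0 : ∀ s, 0 ≤ g s := fun s => Real.sSup_nonneg (by
    rintro _ ⟨x, -, rfl⟩; exact abs_nonneg _)
  have hgle : ∀ s ∈ Icc 0 T, g s ≤ ⨆ y, |c1 y s - c2 y s| := fun s hs => by
    refine Real.sSup_le ?_ (Real.iSup_nonneg fun _ => abs_nonneg _)
    rintro _ ⟨x, -, rfl⟩
    simp only [projIcc_of_mem hT hs]
    exact le_ciSup (bddAbove_velocityGap hC hs) x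
  have hgc : ∀ x ∈ closedBall z R, ∀ s ∈ Icc 0 T, c1 x s - c2 x s ≤ g s := fun x hx s hs => by
    refine (le_abs_self _).trans (le_csSup ?_ ⟨x, hx, by simp only [projIcc_of_mem hT hs]⟩)
    exact (bddAbove_velocityGap hC (projIcc 0 T hT s).2).mono (image_subset_range _ _)
  have hsub : Icc 0 t ⊆ Icc 0 T := Icc_subset_Icc_right ht.2.le
  have hmono : ∫ s in (0 : ℝ)..t, g s ≤ ∫ s in (0 : ℝ)..t, ⨆ y, |c1 y s - c2 y s| :=
    intervalIntegral.integral_mono_on ht.1 (hgcont.intervalIntegrable _ _)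
      ((intervalIntegrable_iff_integrableOn_Icc_of_le ht.1).2
        ((integrableOn_iSup_velocityGap hT hc1 hc2 hC).mono_set hsub))
      fun s hs => hgle s (hsub hs)
  have hk : 0 ≤ K * Real.exp (L * t) := by positivity
  refine le_trans ?_ (mul_le_mul_of_nonneg_left hmono hk)
  refine le_of_forall_pos_le_add fun ε hε => ?_
  have hden : 0 < K * Real.exp (L * t) + t + 1 := by linarith [ht.1]
  set η := ε / (K * Real.exp (L * t) + t + 1) with hη
  have hη0 : 0 < η := div_pos hε hden
  have hηε : η * (K * Real.exp (L * t) + t + 1) = ε := div_mul_cancel₀ _ hden.ne'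
  have := sub_le_of_le_on_cylinder hu0 hL (hL'.trans hL'A) hc2
    (fun x s hs => (hc1b x s hs).trans hL'A) (fun x s hs => (hc2b x s hs).trans hL'A)
    hc2L hu1c hu2c hu1 hu2 ht hAT z hgcont hg0 hgc hη0
  linarith

lemma sub_le_integral_iSup {N : ℕ} {T : ℝ} (hT : 0 < T) {u0 : Euc N → ℝ} {K : ℝ≥0}
    (hu0 : LipschitzWith K u0) {c1 c2 u1 u2 : Euc N → ℝ → ℝ} {L L' : ℝ} (hL : 0 ≤ L)
    (hL' : 0 ≤ L')
    (hc1 : ContinuousOn (fun p : Euc N × ℝ => c1 p.1 p.2) (univ ×ˢ Icc 0 T))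
    (hc2 : ContinuousOn (fun p : Euc N × ℝ => c2 p.1 p.2) (univ ×ˢ Icc 0 T))
    (hc1b : ∀ x, ∀ t ∈ Icc 0 T, |c1 x t| ≤ L') (hc2b : ∀ x, ∀ t ∈ Icc 0 T, |c2 x t| ≤ L')
    (hc2L : ∀ x y, ∀ t ∈ Icc 0 T, |c2 x t - c2 y t| ≤ L * ‖x - y‖)
    (hu1c : ContinuousOn (fun p : Euc N × ℝ => u1 p.1 p.2) (univ ×ˢ Icc 0 T))
    (hu2c : ContinuousOn (fun p : Euc N × ℝ => u2 p.1 p.2) (univ ×ˢ Icc 0 T))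
    (hu1 : IsViscositySolution N T c1 u1 u0) (hu2 : IsViscositySolution N T c2 u2 u0)
    {t : ℝ} (ht : t ∈ Icc 0 T) (z : Euc N) :
    u1 z t - u2 z t ≤
      K * Real.exp (L * t) * ∫ s in (0 : ℝ)..t, ⨆ y, |c1 y s - c2 y s| := by
  have key := fun {t : ℝ} (ht : t ∈ Ico 0 T) => sub_le_integral_iSup_of_lt hu0 hL hL' hc1 hc2
    hc1b hc2b hc2L hu1c hu2c hu1 hu2 ht z
  rcases ht.2.lt_or_eq with hlt | rfl
  · exact key ⟨ht.1, hlt⟩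
  have hC : ∀ x, ∀ s ∈ Icc 0 t, |c1 x s - c2 x s| ≤ L' + L' := fun x s hs =>
    (abs_sub _ _).trans (add_le_add (hc1b x s hs) (hc2b x s hs))
  have hint : IntervalIntegrable (fun s => ⨆ y, |c1 y s - c2 y s|) volume 0 t :=
    (intervalIntegrable_iff_integrableOn_Icc_of_le hT.le).2
      (integrableOn_iSup_velocityGap hT.le hc1 hc2 hC)
  have hcont : ContinuousOn (fun s => u1 z s - u2 z s) (Icc 0 t) :=
    (hu1c.sub hu2c).comp (f := fun s => (z, s)) (by fun_prop) fun s hs => ⟨mem_univ _, hs⟩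
  have htend : Tendsto (fun s => u1 z s - u2 z s) (𝓝[Ico 0 t] t) (𝓝 (u1 z t - u2 z t)) :=
    (hcont t ht).mono Ico_subset_Icc_self
  have : (𝓝[Ico 0 t] t).NeBot := by
    rw [nhdsWithin_Ico_eq_nhdsLT hT]
    infer_instance
  refine le_of_tendsto htend ?_
  filter_upwards [self_mem_nhdsWithin] with s hs
  have hnonneg : ∀ τ, 0 ≤ ⨆ y, |c1 y τ - c2 y τ| := fun τ =>
    Real.iSup_nonneg fun _ => abs_nonneg _
  have hmono : ∫ τ in (0 : ℝ)..s, (⨆ y, |c1 y τ - c2 y τ|)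
      ≤ ∫ τ in (0 : ℝ)..t, ⨆ y, |c1 y τ - c2 y τ| :=
    intervalIntegral.integral_mono_interval le_rfl hs.1 hs.2.le
      (Eventually.of_forall hnonneg) hint
  refine (key hs).trans (mul_le_mul ?_ hmono
    (intervalIntegral.integral_nonneg hs.1 fun τ _ => hnonneg τ) (by positivity))
  gcongr
  exact hs.2.le

/-- L∞-estimate on the difference of two solutions with different velocities. -/
theorem stmt3 (N : ℕ) (hN : 1 ≤ N) (T : ℝ) (hT : 0 < T)
    (u0 : Euc N → ℝ) (K : ℝ≥0) (hu0 : LipschitzWith K u0)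
    (c1 c2 : Euc N → ℝ → ℝ)
    (hc1 : ContinuousOn (fun p : Euc N × ℝ => c1 p.1 p.2)
      ((Set.univ : Set (Euc N)) ×ˢ Set.Icc (0 : ℝ) T))
    (hc2 : ContinuousOn (fun p : Euc N × ℝ => c2 p.1 p.2)
      ((Set.univ : Set (Euc N)) ×ˢ Set.Icc (0 : ℝ) T))
    (L1 L1' : ℝ) (hL1 : 0 < L1) (hL1' : 0 < L1')
    (hH1c1 : ∀ x y : Euc N, ∀ t ∈ Set.Icc (0 : ℝ) T,
      |c1 x t - c1 y t| ≤ L1 * ‖x - y‖ ∧ |c1 x t| ≤ L1')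
    (hH1c2 : ∀ x y : Euc N, ∀ t ∈ Set.Icc (0 : ℝ) T,
      |c2 x t - c2 y t| ≤ L1 * ‖x - y‖ ∧ |c2 x t| ≤ L1')
    (u1 u2 : Euc N → ℝ → ℝ)
    (hu1c : ContinuousOn (fun p : Euc N × ℝ => u1 p.1 p.2)
      ((Set.univ : Set (Euc N)) ×ˢ Set.Icc (0 : ℝ) T))
    (hu2c : ContinuousOn (fun p : Euc N × ℝ => u2 p.1 p.2)
      ((Set.univ : Set (Euc N)) ×ˢ Set.Icc (0 : ℝ) T))
    (hu1 : IsViscositySolution N T c1 u1 u0)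
    (hu2 : IsViscositySolution N T c2 u2 u0) :
    ∀ t ∈ Set.Icc (0 : ℝ) T, ∀ x : Euc N,
      |u1 x t - u2 x t| ≤
        (K : ℝ) * Real.exp (L1 * t) * ∫ s in (0 : ℝ)..t, ⨆ y : Euc N, |c1 y s - c2 y s| := by
  intro t ht x
  rw [abs_sub_le_iff]
  refine ⟨sub_le_integral_iSup hT hu0 hL1.le hL1'.le hc1 hc2 (fun x t ht => (hH1c1 x x t ht).2)
    (fun x t ht => (hH1c2 x x t ht).2) (fun x y t ht => (hH1c2 x y t ht).1) hu1c hu2c hu1 hu2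
    ht x, ?_⟩
  simp only [abs_sub_comm (c1 _ _)]
  exact sub_le_integral_iSup hT hu0 hL1.le hL1'.le hc2 hc1 (fun x t ht => (hH1c2 x x t ht).2)
    (fun x t ht => (hH1c1 x x t ht).2) (fun x y t ht => (hH1c1 x y t ht).1) hu2c hu1c hu2 hu1
    ht x
end
end
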